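/- Let G be a finitely generated one-relator group. Then asdim G ≤ 2. -/

import Mathlib

def wordBall {G : Type*} [Group G] (S : Set G) (R : ℕ) (g : G) : Set G :=
  {h | ∃ w : List G, w.length ≤ R ∧ (∀ x ∈ w, x ∈ S ∨ x⁻¹ ∈ S) ∧ h = g * w.prod}

def AsdimLE (G : Type*) [Group G] (n : ℕ) : Prop :=
  ∀ S : Finset G, Subgroup.closure (S : Set G) = ⊤ →
    ∀ R : ℕ, ∃ 𝒰 : Set (Set G), ⋃₀ 𝒰 = Set.univ ∧
      (∃ B : ℕ, ∀ U ∈ 𝒰, ∀ x ∈ U, ∀ y ∈ U, y ∈ wordBall (S : Set G) B x) ∧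
      ∀ g : G, {U ∈ 𝒰 | (wordBall (S : Set G) R g ∩ U).Nonempty}.Finite ∧
        Nat.card {U ∈ 𝒰 | (wordBall (S : Set G) R g ∩ U).Nonempty} ≤ n + 1

noncomputable def asdim (G : Type*) [Group G] : ℕ∞ :=
  sInf ((↑) '' {n : ℕ | AsdimLE G n})


namespace ORG
open Pointwise

/-- coarse dimension: `n` colours -/
def AD {G : Type} [Group G] (n : ℕ) (Y : Set G) : Prop :=
  ∀ K : Set G, K.Finite → ∃ K' : Set G, K'.Finite ∧ ∃ (c : G → Fin n) (b : G → Set G),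
    (∀ x ∈ Y, ∀ y ∈ Y, c x = c y → x * y⁻¹ ∈ K → b x = b y) ∧
    (∀ x ∈ Y, ∀ y ∈ Y, b x = b y → x * y⁻¹ ∈ K')

lemma lab {G L : Type*} (b : G → L) : ∃ b' : G → Set G, ∀ x y, b' x = b' y ↔ b x = b y := by
  refine ⟨fun x => {z | b z = b x}, fun x y => ⟨fun h => ?_, fun h => by simp [h]⟩⟩
  have : x ∈ {z | b z = b x} := rfl
  have h' : {z | b z = b x} = {z | b z = b y} := h
  rw [h'] at this
  exact this

lemma AD.coarse {G H : Type} [Group G] [Group H] {n : ℕ} (p : G → H) (X : Set G) (Y : Set H)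
    (hp : ∀ x ∈ X, p x ∈ Y)
    (h1 : ∀ K : Set G, K.Finite → ∃ K1 : Set H, K1.Finite ∧
      ∀ x ∈ X, ∀ y ∈ X, x * y⁻¹ ∈ K → p x * (p y)⁻¹ ∈ K1)
    (h2 : ∀ K1 : Set H, K1.Finite → ∃ K : Set G, K.Finite ∧
      ∀ x ∈ X, ∀ y ∈ X, p x * (p y)⁻¹ ∈ K1 → x * y⁻¹ ∈ K)
    (hY : AD n Y) : AD n X := by
  intro K hK
  obtain ⟨K1, hK1, h1⟩ := h1 K hK
  obtain ⟨K2, hK2, c, b, hc, hb⟩ := hY K1 hK1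
  obtain ⟨K3, hK3, h3⟩ := h2 K2 hK2
  obtain ⟨b', hb'⟩ := lab (fun x => b (p x))
  refine ⟨K3, hK3, fun x => c (p x), b', ?_, ?_⟩
  · intro x hx y hy h h'
    exact (hb' x y).2 (hc _ (hp x hx) _ (hp y hy) h (h1 x hx y hy h'))
  · intro x hx y hy h
    exact h3 x hx y hy (hb _ (hp x hx) _ (hp y hy) ((hb' x y).1 h))

lemma AD.of_injective {G H : Type} [Group G] [Group H] {n : ℕ} (f : G →* H)
    (hf : Function.Injective f) (h : AD n (Set.univ : Set H)) : AD n (Set.univ : Set G) := by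
  refine AD.coarse f Set.univ Set.univ (fun _ _ => trivial) ?_ ?_ h
  · intro K hK
    refine ⟨f '' K, hK.image _, fun x _ y _ h => ⟨_, h, by simp⟩⟩
  · intro K hK
    refine ⟨f ⁻¹' K, hK.preimage hf.injOn, fun x _ y _ h => by simpa using h⟩

lemma AD.of_range {G H : Type} [Group G] [Group H] {n : ℕ} (f : G →* H)
    (hf : Function.Injective f) (h : AD n (Set.univ : Set G)) : AD n (f.range : Set H) := by
  classical
  choose! p hp using fun (x : H) (hx : x ∈ f.range) => hx
  refine AD.coarse p (f.range : Set H) Set.univ (fun _ _ => trivial) ?_ ?_ h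
  · intro K hK
    refine ⟨f ⁻¹' K, hK.preimage hf.injOn, fun x hx y hy h => ?_⟩
    simpa [hp x hx, hp y hy] using h
  · intro K hK
    refine ⟨f '' K, hK.image _, fun x hx y hy h => ⟨_, h, ?_⟩⟩
    simp [hp x hx, hp y hy]

lemma AD.nbhd {G : Type} [Group G] {n : ℕ} {X Y F : Set G} (hF : F.Finite)
    (hX : X ⊆ F * Y) (h : AD n Y) : AD n X := by
  classical
  have : ∀ x, ∃ y, x ∈ X → y ∈ Y ∧ x * y⁻¹ ∈ F := by
    intro x
    by_cases hx : x ∈ X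
    · obtain ⟨f, hf, y, hy, rfl⟩ := hX hx
      exact ⟨y, fun _ => ⟨hy, by simpa using hf⟩⟩
    · exact ⟨1, fun h => absurd h hx⟩
  choose p hp using this
  refine AD.coarse p _ _ (fun x hx => (hp x hx).1) ?_ ?_ h
  · intro K hK
    refine ⟨F⁻¹ * K * F, (hF.inv.mul hK).mul hF, fun x hx y hy h => ?_⟩
    refine ⟨(x * (p x)⁻¹)⁻¹ * (x * y⁻¹), ⟨_, Set.inv_mem_inv.2 (hp x hx).2, _, h, rfl⟩,
      _, (hp y hy).2, ?_⟩
    group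
  · intro K hK
    refine ⟨F * K * F⁻¹, (hF.mul hK).mul hF.inv, fun x hx y hy h => ?_⟩
    refine ⟨(x * (p x)⁻¹) * (p x * (p y)⁻¹), ⟨_, (hp x hx).2, _, h, rfl⟩,
      _, Set.inv_mem_inv.2 (hp y hy).2, ?_⟩
    group

lemma AD.succ {G : Type} [Group G] {n : ℕ} {X : Set G} (h : AD n X) : AD (n+1) X := by
  intro K hK
  obtain ⟨K', hK', c, b, h1, h2⟩ := h K hK
  refine ⟨K', hK', fun x => (c x).castSucc, b, ?_, h2⟩
  intro x hx y hy hc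
  exact h1 x hx y hy (Fin.castSucc_injective _ hc)

/-- Kolmogorov trick -/
lemma AD.kolm {G : Type} [Group G] {Y : Set G} (h : AD 2 Y) (K : Set G) (hK : K.Finite)
    (hK1 : 1 ∈ K) (hKi : ∀ x ∈ K, x⁻¹ ∈ K) :
    ∃ K' : Set G, K'.Finite ∧ ∃ (m : Fin 3 → G → Prop) (b : Fin 3 → G → Set G),
      (∀ x ∈ Y, ∀ i, ∃ j, j ≠ i ∧ m j x) ∧
      (∀ i, ∀ x ∈ Y, ∀ y ∈ Y, m i x → m i y → x * y⁻¹ ∈ K → b i x = b i y) ∧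
      (∀ i, ∀ x ∈ Y, ∀ y ∈ Y, m i x → m i y → b i x = b i y → x * y⁻¹ ∈ K') := by
  classical
  obtain ⟨K', hK', c, b, h1, h2⟩ := h (K * K * K) ((hK.mul hK).mul hK)
  let near : Fin 2 → G → Prop := fun i x => ∃ y ∈ Y, c y = i ∧ x * y⁻¹ ∈ K
  have : ∀ i x, ∃ y, near i x → y ∈ Y ∧ c y = i ∧ x * y⁻¹ ∈ K := by
    intro i x
    by_cases hx : near i x
    · obtain ⟨y, hy⟩ := hx
      exact ⟨y, fun _ => hy⟩
    · exact ⟨1, fun h => absurd h hx⟩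
  choose p hp using this
  have self : ∀ x ∈ Y, near (c x) x := fun x hx => ⟨x, hx, rfl, by simpa using hK1⟩
  let m : Fin 3 → G → Prop := ![near 0, near 1, fun x => ¬ (near 0 x ∧ near 1 x)]
  let b' : Fin 3 → G → Set G := ![fun x => b (p 0 x), fun x => b (p 1 x), b]
  have key : ∀ i x y, near i x → near i y → x * y⁻¹ ∈ K → b (p i x) = b (p i y) := by
    intro i x y hx hy hxy
    obtain ⟨a1, a2, a3⟩ := hp i x hx
    obtain ⟨b1, b2, b3⟩ := hp i y hy
    refine h1 _ a1 _ b1 (a2.trans b2.symm) ?_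
    refine ⟨(x * (p i x)⁻¹)⁻¹ * (x * y⁻¹), ⟨_, hKi _ a3, _, hxy, rfl⟩, _, b3, ?_⟩
    group
  have key2 : ∀ i x y, near i x → near i y → b (p i x) = b (p i y) → x * y⁻¹ ∈ K * K' * K := by
    intro i x y hx hy hxy
    obtain ⟨a1, a2, a3⟩ := hp i x hx
    obtain ⟨b1, b2, b3⟩ := hp i y hy
    refine ⟨(x * (p i x)⁻¹) * (p i x * (p i y)⁻¹), ⟨_, a3, _, h2 _ a1 _ b1 hxy, rfl⟩,
      _, hKi _ b3, ?_⟩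
    group
  refine ⟨(K * K' * K) ∪ K', ((hK.mul hK').mul hK).union hK', m, b', ?_, ?_, ?_⟩
  · intro x hx i
    have hs := self x hx
    have two : c x = 0 ∨ c x = 1 := by omega
    by_cases hb : near 0 x ∧ near 1 x
    · by_cases hi : i = 0
      · exact ⟨1, by simp [hi], hb.2⟩
      · exact ⟨0, fun h => hi h.symm, hb.1⟩
    · by_cases hi : i = 2
      · rcases two with h | h
        · exact ⟨0, by simp [hi], by rw [h] at hs; exact hs⟩
        · exact ⟨1, by simp [hi], by rw [h] at hs; exact hs⟩
      · exact ⟨2, fun h => hi h.symm, hb⟩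
  · intro i x hx y hy mx my hxy
    fin_cases i
    · exact key 0 x y mx my hxy
    · exact key 1 x y mx my hxy
    · have hcc : c x = c y := by
        by_contra hne
        apply mx
        have h1 := self x hx
        have h2 : near (c y) x := ⟨y, hy, rfl, hxy⟩
        have two : c x = 0 ∨ c x = 1 := by omega
        have two' : c y = 0 ∨ c y = 1 := by omega
        rcases two with h | h <;> rcases two' with h' | h' <;> simp_all
      refine h1 x hx y hy hcc ?_
      exact ⟨1 * 1, ⟨1, hK1, 1, hK1, rfl⟩, _, hxy, by simp⟩
  · intro i x hx y hy mx my hxy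
    fin_cases i
    · exact Or.inl (key2 0 x y mx my hxy)
    · exact Or.inl (key2 1 x y mx my hxy)
    · exact Or.inr (h2 x hx y hy hxy)

/-- absorbing one colouring into another -/
lemma absorb {G : Type} [Group G] {n : ℕ} {L1 L2 : Type*} (K X Y KZ KY : Set G) (hK : K.Finite)
    (hKi : ∀ x ∈ K, x⁻¹ ∈ K) (hKZ : KZ.Finite) (hKY : KY.Finite)
    (c : G → Fin n) (bZ : G → L1) (bY : G → L2)
    (h1 : ∀ x ∈ X, ∀ y ∈ X, x ∉ Y → y ∉ Y → c x = c y → x * y⁻¹ ∈ K → bZ x = bZ y)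
    (h1' : ∀ x ∈ X, ∀ y ∈ X, x ∉ Y → y ∉ Y → bZ x = bZ y → x * y⁻¹ ∈ KZ)
    (h2 : ∀ x ∈ X, ∀ y ∈ X, x ∈ Y → y ∈ Y → c x = c y → x * y⁻¹ ∈ K → bY x = bY y)
    (h3 : ∀ x ∈ X, ∀ y ∈ X, x ∈ Y → y ∈ Y → ∀ z ∈ X, ∀ w ∈ X, z ∉ Y → w ∉ Y →
      c x = c y → c z = c x → c w = c x → x * z⁻¹ ∈ K → bZ z = bZ w → w * y⁻¹ ∈ K → bY x = bY y)
    (h2' : ∀ x ∈ X, ∀ y ∈ X, x ∈ Y → y ∈ Y → bY x = bY y → x * y⁻¹ ∈ KY) :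
    ∃ K' : Set G, K'.Finite ∧ ∃ (b : G → Set G),
    (∀ x ∈ X, ∀ y ∈ X, c x = c y → x * y⁻¹ ∈ K → b x = b y) ∧
    (∀ x ∈ X, ∀ y ∈ X, b x = b y → x * y⁻¹ ∈ K') := by
  classical
  let P : L1 × Fin n → G × G → Prop := fun l q =>
    q.1 ∈ X ∧ q.1 ∉ Y ∧ q.2 ∈ X ∧ q.2 ∈ Y ∧ c q.1 = l.2 ∧ bZ q.1 = l.1 ∧ c q.2 = l.2 ∧
      q.1 * q.2⁻¹ ∈ K
  let bb : L1 × Fin n → L2 ⊕ (L1 × Fin n) := fun l =>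
    if h : ∃ q, P l q then Sum.inl (bY (Classical.choose h).2) else Sum.inr l
  let b0 : G → L2 ⊕ (L1 × Fin n) := fun x =>
    if x ∈ Y then Sum.inl (bY x) else bb (bZ x, c x)
  have b0Y : ∀ x ∈ Y, b0 x = Sum.inl (bY x) := fun x hx => if_pos hx
  have b0Z : ∀ x, x ∉ Y → b0 x = bb (bZ x, c x) := fun x hx => if_neg hx
  have mixed : ∀ x ∈ X, ∀ y ∈ X, x ∈ Y → y ∉ Y → c x = c y → y * x⁻¹ ∈ K → b0 x = b0 y := by
    intro x hx y hy hxY hyY hc hk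
    have hex : ∃ q, P (bZ y, c y) q := ⟨(y, x), hy, hyY, hx, hxY, rfl, rfl, hc, hk⟩
    rw [b0Y x hxY, b0Z y hyY]
    simp only [bb, dif_pos hex]
    obtain ⟨q1, q2, q3, q4, q5, q6, q7, q8⟩ := Classical.choose_spec hex
    set q := Classical.choose hex
    congr 1
    symm
    refine h3 _ q3 _ hx q4 hxY _ q1 _ hy q2 hyY ?_ ?_ ?_ ?_ q6 hk
    · rw [q7, hc]
    · rw [q7, q5]
    · rw [q7]
    · simpa using hKi _ q8
  have rep : ∀ x ∈ X, ∀ l, b0 x = Sum.inl l → ∃ x' ∈ X, x' ∈ Y ∧ bY x' = l ∧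
      x * x'⁻¹ ∈ ({1} ∪ KZ * K : Set G) := by
    intro x hx l hl
    by_cases hxY : x ∈ Y
    · rw [b0Y x hxY] at hl
      exact ⟨x, hx, hxY, Sum.inl_injective hl, by simp⟩
    · rw [b0Z x hxY] at hl
      by_cases hex : ∃ q, P (bZ x, c x) q
      · simp only [bb, dif_pos hex] at hl
        obtain ⟨q1, q2, q3, q4, q5, q6, q7, q8⟩ := Classical.choose_spec hex
        set q := Classical.choose hex
        refine ⟨q.2, q3, q4, Sum.inl_injective hl, Or.inr
          ⟨_, h1' x hx _ q1 hxY q2 q6.symm, _, q8, ?_⟩⟩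
        group
      · simp only [bb, dif_neg hex] at hl
        cases hl
  obtain ⟨b, hb⟩ := lab b0
  have hJ : ({1} ∪ KZ * K : Set G).Finite := (Set.finite_singleton _).union (hKZ.mul hK)
  refine ⟨(({1} ∪ KZ * K) * KY * ({1} ∪ KZ * K)⁻¹) ∪ KZ, ((hJ.mul hKY).mul hJ.inv).union hKZ,
    b, ?_, ?_⟩
  · intro x hx y hy hc hk
    rw [hb]
    by_cases hxY : x ∈ Y <;> by_cases hyY : y ∈ Y
    · rw [b0Y x hxY, b0Y y hyY, h2 x hx y hy hxY hyY hc hk]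
    · exact mixed x hx y hy hxY hyY hc (by simpa using hKi _ hk)
    · exact (mixed y hy x hx hyY hxY hc.symm hk).symm
    · rw [b0Z x hxY, b0Z y hyY, h1 x hx y hy hxY hyY hc hk, hc]
  · intro x hx y hy h
    rw [hb] at h
    cases hl : b0 x with
    | inl l =>
      obtain ⟨x', a1, a2, a3, a4⟩ := rep x hx l hl
      obtain ⟨y', b1, b2, b3, b4⟩ := rep y hy l (h ▸ hl)
      left
      refine ⟨(x * x'⁻¹) * (x' * y'⁻¹), ⟨_, a4, _, h2' _ a1 _ b1 a2 b2 (a3.trans b3.symm), rfl⟩,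
        _, Set.inv_mem_inv.2 b4, ?_⟩
      group
    | inr l =>
      right
      have aux : ∀ z, b0 z = Sum.inr l → z ∉ Y ∧ l = (bZ z, c z) := by
        intro z hz
        have hzY : z ∉ Y := by
          intro hzY
          rw [b0Y z hzY] at hz
          cases hz
        refine ⟨hzY, ?_⟩
        rw [b0Z z hzY] at hz
        by_cases hex : ∃ q, P (bZ z, c z) q
        · simp only [bb, dif_pos hex] at hz
          cases hz
        · simp only [bb, dif_neg hex] at hz
          exact (Sum.inr_injective hz).symm
      obtain ⟨a1, a2⟩ := aux x hl
      obtain ⟨b1, b2⟩ := aux y (h ▸ hl)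
      refine h1' x hx y hy a1 b1 ?_
      rw [a2] at b2
      exact (Prod.ext_iff.1 b2).1

end ORG

namespace ORG
open Pointwise

def Desc {G L : Type} [Group G] (v : G → List L) (t z : G) : Prop :=
  ∃ s, (s = t ∨ s = t⁻¹) ∧ ∃ a, v z = a :: v (s * z)

structure IsTr {G L : Type} [Group G] (v : G → List L) (H A B : Subgroup G) (t : G) : Prop where
  one : v 1 = []
  inv : ∀ h ∈ H, ∀ x, v (h * x) = v x
  fib : ∀ x y, v x = v y → x * y⁻¹ ∈ H
  step : ∀ s, (s = t ∨ s = t⁻¹) → ∀ x, (∃ a, v (s * x) = a :: v x) ∨ ∃ a, v x = a :: v (s * x)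
  down : ∀ x a l, v x = a :: l → ∃ s, (s = t ∨ s = t⁻¹) ∧ ∃ h ∈ H, v (s * (h * x)) = l
  edge : ∀ l, (∀ x y, v x = l → v y = l → Desc v t x → Desc v t y → x * y⁻¹ ∈ A) ∨
    (∀ x y, v x = l → v y = l → Desc v t x → Desc v t y → x * y⁻¹ ∈ B)
  gen : Subgroup.closure ((H : Set G) ∪ {t}) = ⊤

structure GS {G : Type} [Group G] (S : Set G) (H : Subgroup G) (t : G) : Prop where
  fin : S.Finite
  one : 1 ∈ S
  inv : ∀ s ∈ S, s⁻¹ ∈ S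
  sub : ∀ s ∈ S, s ∈ H ∨ s = t ∨ s = t⁻¹

section
variable {G L : Type} [Group G] {v : G → List L} {H A B : Subgroup G} {t : G} {S : Set G}

lemma GS.pow_inv (hS : GS S H t) (j : ℕ) : ∀ x ∈ S ^ j, x⁻¹ ∈ S ^ j := by
  have : S⁻¹ = S := by
    ext x
    exact ⟨fun h => by simpa using hS.inv _ h, fun h => hS.inv _ h⟩
  intro x hx
  rw [← Set.mem_inv, ← inv_pow, this]
  exact hx

lemma GS.pow_mono (hS : GS S H t) {i j : ℕ} (h : i ≤ j) : S ^ i ⊆ S ^ j :=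
  Set.pow_subset_pow_right hS.one h

lemma GS.tri {S : Set G} {i j : ℕ} (m : ℕ) {x y z : G} (h1 : x * y⁻¹ ∈ S ^ i)
    (h2 : y * z⁻¹ ∈ S ^ j) (hm : m = i + j) : x * z⁻¹ ∈ S ^ m := by
  rw [hm, pow_add]
  exact ⟨_, h1, _, h2, by group⟩

lemma GS.symm (hS : GS S H t) {i : ℕ} {x y : G} (h1 : x * y⁻¹ ∈ S ^ i) : y * x⁻¹ ∈ S ^ i := by
  have := hS.pow_inv i _ h1
  simpa using this

lemma GS.finpow (hS : GS S H t) (i : ℕ) : (S ^ i).Finite := by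
  induction i with
  | zero => simp
  | succ i ih => rw [pow_succ]; exact ih.mul hS.fin

lemma IsTr.gs (hT : IsTr v H A B t) (K : Set G) (hK : K.Finite) :
    ∃ S k, GS S H t ∧ K ⊆ S ^ k := by
  have un : ∀ {S S' : Set G}, GS S H t → GS S' H t → GS (S ∪ S') H t := by
    intro S S' h h'
    refine ⟨h.fin.union h'.fin, Or.inl h.one, ?_, ?_⟩
    · rintro s (hs | hs)
      · exact Or.inl (h.inv _ hs)
      · exact Or.inr (h'.inv _ hs)
    · rintro s (hs | hs)
      · exact h.sub _ hs
      · exact h'.sub _ hs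
  have el : ∀ g : G, ∃ S k, GS S H t ∧ g ∈ S ^ k := by
    intro g
    have hg : g ∈ Subgroup.closure ((H : Set G) ∪ {t}) := by rw [hT.gen]; trivial
    induction hg using Subgroup.closure_induction with
    | mem x hx =>
      refine ⟨{1, x, x⁻¹}, 1, ⟨by simp, by simp, by simp, ?_⟩, by simp⟩
      rintro s (rfl | rfl | rfl)
      · exact Or.inl H.one_mem
      · rcases hx with h | h
        · exact Or.inl h
        · exact Or.inr (Or.inl h)
      · rcases hx with h | h
        · exact Or.inl (H.inv_mem h)
        · exact Or.inr (Or.inr (by rw [h]))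
    | one =>
      refine ⟨{1}, 0, ⟨by simp, by simp, by simp, ?_⟩, by simp⟩
      rintro s rfl
      exact Or.inl H.one_mem
    | mul x y _ _ hx hy =>
      obtain ⟨S, k, h1, h2⟩ := hx
      obtain ⟨S', k', h1', h2'⟩ := hy
      refine ⟨S ∪ S', k + k', un h1 h1', ?_⟩
      rw [pow_add]
      exact Set.mul_mem_mul (Set.pow_subset_pow_left Set.subset_union_left h2)
        (Set.pow_subset_pow_left Set.subset_union_right h2')
    | inv x _ hx =>
      obtain ⟨S, k, h1, h2⟩ := hx
      exact ⟨S, k, h1, h1.pow_inv _ _ h2⟩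
  induction K, hK using Set.Finite.induction_on with
  | empty =>
    obtain ⟨S, k, h, _⟩ := el 1
    exact ⟨S, k, h, by simp⟩
  | insert _ _ ih =>
    rename_i a s _ _
    obtain ⟨S, k, h1, h2⟩ := ih
    obtain ⟨S', k', h1', h2'⟩ := el a
    refine ⟨S ∪ S', k + k', un h1 h1', ?_⟩
    apply Set.insert_subset
    · exact (un h1 h1').pow_mono (by omega) (Set.pow_subset_pow_left Set.subset_union_right h2')
    · exact (h2.trans (Set.pow_subset_pow_left Set.subset_union_left)).trans
        ((un h1 h1').pow_mono (by omega))

lemma IsTr.sstep (hT : IsTr v H A B t) (hS : GS S H t) {s : G} (hs : s ∈ S) (x : G) :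
    v (s * x) = v x ∨ (∃ a, v (s * x) = a :: v x) ∨
      ((s = t ∨ s = t⁻¹) ∧ ∃ a, v x = a :: v (s * x)) := by
  rcases hS.sub s hs with h | h
  · exact Or.inl (hT.inv _ h x)
  · rcases hT.step s h x with h' | h'
    · exact Or.inr (Or.inl h')
    · exact Or.inr (Or.inr ⟨h, h'⟩)

/-- length is Lipschitz -/
lemma IsTr.lip (hT : IsTr v H A B t) (hS : GS S H t) (j : ℕ) : ∀ {x y : G}, x * y⁻¹ ∈ S ^ j →
    (v x).length ≤ (v y).length + j := by
  induction j with
  | zero =>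
    intro x y h
    rw [pow_zero, Set.mem_one, mul_inv_eq_one] at h
    simp [h]
  | succ j ih =>
    intro x y h
    rw [pow_succ] at h
    obtain ⟨w, hw, s, hs, h⟩ := h
    have h0 : x * (s * y)⁻¹ = w := by
      have h : w * s = x * y⁻¹ := h
      rw [mul_inv_rev, ← mul_assoc, ← h]; group
    have := ih (x := x) (y := s * y) (by rw [h0]; exact hw)
    rcases hT.sstep hS hs y with h1 | ⟨a, h1⟩ | ⟨_, a, h1⟩
    · rw [h1] at this; omega
    · rw [h1] at this; simp at this; omega
    · rw [h1]; simp; omega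

lemma IsTr.exit (hT : IsTr v H A B t) (hS : GS S H t) (j : ℕ) : ∀ {x y : G} {l : List L},
    x * y⁻¹ ∈ S ^ j → l <:+ v y → ¬ l <:+ v x →
    ∃ z, v z = l ∧ Desc v t z ∧ y * z⁻¹ ∈ S ^ j ∧ x * z⁻¹ ∈ S ^ j ∧
      ∃ s ∈ S, (v (s * z)).length < (v z).length := by
  induction j with
  | zero =>
    intro x y l h h1 h2
    rw [pow_zero, Set.mem_one, mul_inv_eq_one] at h
    rw [h] at h2
    exact absurd h1 h2
  | succ j ih =>
    intro x y l h h1 h2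
    have h' := h
    rw [pow_succ] at h
    obtain ⟨w, hw, s, hs, h⟩ := h
    have h0 : x * (s * y)⁻¹ = w := by
      have h : w * s = x * y⁻¹ := h
      rw [mul_inv_rev, ← mul_assoc, ← h]; group
    by_cases hl : l <:+ v (s * y)
    · obtain ⟨z, z1, z2, z3, z4, z5⟩ := ih (x := x) (y := s * y) (by rw [h0]; exact hw) hl h2
      refine ⟨z, z1, z2, ?_, hS.pow_mono (Nat.le_succ j) z4, z5⟩
      rw [pow_succ']
      exact ⟨_, hS.inv _ hs, _, z3, by group⟩
    · rcases hT.sstep hS hs y with h3 | ⟨a, h3⟩ | ⟨h4, a, h3⟩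
      · rw [h3] at hl; exact absurd h1 hl
      · rw [h3] at hl; exact absurd (h1.trans (List.suffix_cons _ _)) hl
      · refine ⟨y, ?_, ⟨s, h4, a, h3⟩, ?_, h', s, hs, by simp [h3]⟩
        · rw [h3, List.suffix_cons_iff] at h1
          rw [h3]
          exact (h1.resolve_right hl).symm
        · rw [mul_inv_cancel]
          exact Set.one_mem_pow hS.one

lemma IsTr.rel (hT : IsTr v H A B t) : ∀ (l : List L) {x g : G}, v x = l ++ v g →
    (v (x * g⁻¹)).length ≤ l.length := by
  intro l
  induction l with
  | nil =>
    intro x g h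
    have := hT.inv _ (hT.fib x g h) 1
    rw [mul_one, hT.one] at this
    simp [this]
  | cons a l ih =>
    intro x g h
    obtain ⟨s, hs, k, hk, h1⟩ := hT.down x a _ h
    have h2 := ih h1
    have h3 := hT.inv k hk (x * g⁻¹)
    rw [← h3]
    have h4 : s * (k * x) * g⁻¹ = s * (k * (x * g⁻¹)) := by group
    rw [h4] at h2
    rcases hT.step s hs (k * (x * g⁻¹)) with ⟨b, h5⟩ | ⟨b, h5⟩
    · rw [h5] at h2; simp at h2 ⊢; omega
    · rw [h5]; simp; omega

lemma IsTr.real (hT : IsTr v H A B t) (l : List L) : ∀ (l' : List L) (x : G), v x = l' ++ l →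
    ∃ g, v g = l := by
  intro l'
  induction l' with
  | nil => exact fun x h => ⟨x, h⟩
  | cons a l' ih =>
    intro x h
    obtain ⟨s, hs, k, hk, h1⟩ := hT.down x a _ h
    exact ih _ h1

lemma IsTr.ball (hT : IsTr v H A B t) (hH : AD 3 (H : Set G)) (j : ℕ) :
    AD 3 {x | (v x).length ≤ j} := by
  classical
  have hbase : ∃ g : List L → G, ∀ x, v (g (v x)) = v x := by
    have : ∀ l, ∃ g, (∃ x, v x = l) → v g = l := by
      intro l
      by_cases h : ∃ x, v x = l
      · obtain ⟨x, hx⟩ := h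
        exact ⟨x, fun _ => hx⟩
      · exact ⟨1, fun h' => absurd h' h⟩
    choose g hg using this
    exact ⟨g, fun x => hg _ ⟨x, rfl⟩⟩
  obtain ⟨g, hg⟩ := hbase
  induction j with
  | zero =>
    have : {x | (v x).length ≤ 0} = (H : Set G) := by
      ext x
      simp only [Nat.le_zero, List.length_eq_zero_iff, Set.mem_ofPred_eq]
      constructor
      · intro h
        have := hT.fib x 1 (by rw [h, hT.one])
        simpa using this
      · intro h
        have := hT.inv x h 1
        rwa [mul_one, hT.one] at this
    rw [this]
    exact hH
  | succ j ih =>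
    intro K0 hK0
    obtain ⟨S, k, hS, hKS⟩ := hT.gs K0 hK0
    set K := S ^ k with hKdef
    have hK : K.Finite := hS.finpow k
    set Y := S ^ (k + 1) * {x | (v x).length ≤ j} with hY
    have hADY : AD 3 Y := AD.nbhd (hS.finpow (k+1)) subset_rfl ih
    obtain ⟨KZ, hKZ, cZ, bZ, hZ1, hZ2⟩ := hH K hK
    obtain ⟨KY, hKY, cY, bY, hY1, hY2⟩ := hADY (K ∪ K * KZ * K) (hK.union ((hK.mul hKZ).mul hK))
    let c : G → Fin 3 := fun x => if x ∈ Y then cY x else cZ (x * (g (v x))⁻¹)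
    have cin : ∀ x ∈ Y, c x = cY x := fun x hx => if_pos hx
    have cout : ∀ x, x ∉ Y → c x = cZ (x * (g (v x))⁻¹) := fun x hx => if_neg hx
    have hlen : ∀ x, (v x).length ≤ j → x ∈ Y := fun x hx =>
      ⟨1, Set.one_mem_pow hS.one, x, hx, by simp⟩
    have hgm : ∀ x, x * (g (v x))⁻¹ ∈ H := fun x => hT.fib _ _ (hg x).symm
    refine Exists.elim (absorb (n := 3) K {x | (v x).length ≤ j + 1} Y KZ KY hK
      (hS.pow_inv k) hKZ hKY c (fun x => (v x, bZ (x * (g (v x))⁻¹))) bY ?_ ?_ ?_ ?_ ?_) ?_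
    rotate_left 5
    · rintro K' ⟨hK', b, hb1, hb2⟩
      exact ⟨K', hK', c, b, fun x hx y hy hc h => hb1 x hx y hy hc (hKS h), hb2⟩
    · intro x hx y hy hxY hyY hc hk
      have hv : v y = v x := by
        by_contra hne
        have h1 : (v x).length = j + 1 := by
          have := mt (hlen x) hxY
          simp at hx; omega
        have h2 : (v y).length = j + 1 := by
          have := mt (hlen y) hyY
          simp at hy; omega
        have h3 : ¬ v y <:+ v x := fun h => hne (h.eq_of_length (h2.trans h1.symm))
        obtain ⟨z, z1, _, z3, _, s, hs, z2⟩ := hT.exit hS k hk (List.suffix_refl _) h3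
        apply hyY
        refine ⟨(y * z⁻¹) * s⁻¹, ?_, s * z, ?_, by group⟩
        · rw [pow_succ]
          exact Set.mul_mem_mul z3 (hS.inv _ hs)
        · rw [z1, h2] at z2
          exact Nat.lt_succ_iff.1 z2
      rw [cout x hxY, cout y hyY] at hc
      rw [hv] at hc ⊢
      congr 1
      refine hZ1 _ (hgm x) _ (hv ▸ hgm y) hc ?_
      have : x * (g (v x))⁻¹ * (y * (g (v x))⁻¹)⁻¹ = x * y⁻¹ := by group
      rw [this]; exact hk
    · intro x hx y hy hxY hyY hb
      obtain ⟨hv, hb⟩ := Prod.ext_iff.1 hb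
      simp only at hv hb
      rw [← hv] at hb
      have := hZ2 _ (hgm x) _ (hv ▸ hgm y) hb
      have h' : x * (g (v x))⁻¹ * (y * (g (v x))⁻¹)⁻¹ = x * y⁻¹ := by group
      rwa [h'] at this
    · intro x hx y hy hxY hyY hc hk
      rw [cin x hxY, cin y hyY] at hc
      exact hY1 x hxY y hyY hc (Or.inl hk)
    · intro x hx y hy hxY hyY z hz w hw hzY hwY hc hc1 hc2 hk hb hk2
      rw [cin x hxY, cin y hyY] at hc
      refine hY1 x hxY y hyY hc (Or.inr ?_)
      obtain ⟨hv, hb⟩ := Prod.ext_iff.1 hb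
      simp only at hv hb
      rw [← hv] at hb
      have := hZ2 _ (hgm z) _ (hv ▸ hgm w) hb
      have h' : z * (g (v z))⁻¹ * (w * (g (v z))⁻¹)⁻¹ = z * w⁻¹ := by group
      rw [h'] at this
      exact ⟨_, ⟨_, hk, _, this, rfl⟩, _, hk2, by group⟩
    · exact fun x hx y hy hxY hyY hb => hY2 x hxY y hyY hb

end
end ORG

namespace ORG
open Pointwise

def ee {G L : Type} (v : G → List L) (R : ℕ) (x : G) : List L := (v x).drop ((v x).length % R)

def Near {G L : Type} [Group G] (v : G → List L) (t : G) (S : Set G) (R j : ℕ) (x : G) : Prop :=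
  ee v R x ≠ [] ∧ ∃ y, v y = ee v R x ∧ Desc v t y ∧ x * y⁻¹ ∈ S ^ j

open Classical in
noncomputable def qq {G L : Type} [Group G] (v : G → List L) (t : G) (S : Set G) (R k : ℕ)
    (x : G) : List L :=
  if Near v t S R k x then (ee v R x).drop R else ee v R x

section
variable {G L : Type} [Group G] {v : G → List L} {H A B : Subgroup G} {t : G} {S : Set G}

lemma ee_suf (v : G → List L) (R : ℕ) (x : G) : ee v R x <:+ v x := List.drop_suffix _ _

lemma ee_len (v : G → List L) (R : ℕ) (x : G) :
    (ee v R x).length = R * ((v x).length / R) := by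
  have := Nat.div_add_mod (v x).length R
  simp only [ee, List.length_drop]
  omega

lemma ee_len_le (v : G → List L) (R : ℕ) (x : G) :
    (ee v R x).length ≤ (v x).length := (ee_suf v R x).length_le

lemma ee_len_lt (v : G → List L) {R : ℕ} (hR : 0 < R) (x : G) :
    (v x).length < (ee v R x).length + R := by
  rw [ee_len]
  have := Nat.div_add_mod (v x).length R
  have := Nat.mod_lt (v x).length hR
  omega

lemma suf_eq {l l' m : List L} (h : l <:+ m) (h' : l' <:+ m) (hl : l.length = l'.length) :
    l = l' := by
  rcases List.suffix_or_suffix_of_suffix h h' with h | h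
  · exact h.eq_of_length hl
  · exact (h.eq_of_length hl.symm).symm

lemma ee_max (v : G → List L) {R : ℕ} (hR : 0 < R) (x : G) {l : List L} {m : ℕ} (h : l <:+ v x)
    (hl : l.length = R * m) (hx : (v x).length < l.length + R) : ee v R x = l := by
  refine suf_eq (ee_suf v R x) h ?_
  rw [ee_len, hl]
  congr 1
  have := h.length_le
  rw [hl] at this hx
  refine Nat.div_eq_of_lt_le ?_ ?_
  · rw [mul_comm]; exact this
  · rw [mul_comm, mul_add, mul_one]; exact hx

lemma mul_close {R a b : ℕ} (h : R * a < R * b + R) : R * a ≤ R * b := by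
  by_contra h'
  have : b < a := by
    by_contra h2
    exact h' (Nat.mul_le_mul_left R (by omega))
  have := Nat.mul_le_mul_left R this
  rw [Nat.mul_succ] at this
  omega

lemma Near.mono (hS : GS S H t) {R i j : ℕ} {x : G} (h : Near v t S R i x) (hij : i ≤ j) :
    Near v t S R j x := by
  obtain ⟨h1, y, h2, h3, h4⟩ := h
  exact ⟨h1, y, h2, h3, hS.pow_mono hij h4⟩

lemma Near.trans {R i j : ℕ} {x y : G} (m : ℕ) (h : Near v t S R i x)
    (he : ee v R y = ee v R x) (hy : y * x⁻¹ ∈ S ^ j) (hm : m = j + i) : Near v t S R m y := by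
  obtain ⟨h1, z, h2, h3, h4⟩ := h
  exact ⟨he ▸ h1, z, he ▸ h2, h3, GS.tri m hy h4 hm⟩

/-- not near: suffix persists -/
lemma IsTr.persist (hT : IsTr v H A B t) (hS : GS S H t) {R j : ℕ} {x y : G}
    (hx : ¬ Near v t S R j x) (hxy : y * x⁻¹ ∈ S ^ j) : ee v R x <:+ v y := by
  by_contra h
  obtain ⟨z, z1, z2, z3, _⟩ := hT.exit hS j hxy (ee_suf v R x) h
  refine hx ⟨?_, z, z1, z2, z3⟩
  intro h0
  rw [h0] at h
  exact h (List.nil_suffix)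

lemma IsTr.long (hT : IsTr v H A B t) (hS : GS S H t) {j : ℕ} {x y : G} {l : List L}
    (hl : l <:+ v x) (hll : l.length + j < (v x).length) (hxy : y * x⁻¹ ∈ S ^ j) : l <:+ v y := by
  by_contra h
  obtain ⟨z, z1, z2, z3, _⟩ := hT.exit hS j hxy hl h
  have := hT.lip hS j z3
  rw [z1] at this
  omega

lemma IsTr.claimB (hT : IsTr v H A B t) (hS : GS S H t) {R k : ℕ} (hR : 10 * k < R) {x y : G}
    (hx : ¬ Near v t S R k x) (hx' : Near v t S R (4 * k) x) (hxy : x * y⁻¹ ∈ S ^ k) :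
    ee v R y = ee v R x := by
  obtain ⟨h1, z, h2, h3, h4⟩ := hx'
  have hyx := hS.symm hxy
  refine ee_max v (by omega) y (hT.persist hS hx hyx) (ee_len v R x) ?_
  have := hT.lip hS _ (GS.tri (5 * k) hyx h4 (by omega))
  rw [h2] at this
  omega

lemma IsTr.claimLH (hT : IsTr v H A B t) (hS : GS S H t) {R k : ℕ} (hR : 10 * k < R) {x y : G}
    (hx : Near v t S R k x) (hy : ¬ Near v t S R (4 * k) y) (hxy : x * y⁻¹ ∈ S ^ k) :
    (ee v R x).drop R = ee v R y := by
  obtain ⟨h1, z, h2, h3, h4⟩ := hx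
  have hyx := hS.symm hxy
  have hyz := GS.tri (2 * k) hyx h4 (by omega)
  have hzy := hS.symm hyz
  have l1 := hT.lip hS _ hyz
  rw [h2] at l1
  have hl0 : R ≤ (ee v R x).length := by
    have h5 : (ee v R x).length ≠ 0 := by simpa using h1
    rw [ee_len] at h5 ⊢
    refine Nat.le_mul_of_pos_right R (Nat.pos_of_ne_zero ?_)
    intro h; rw [h] at h5; simp at h5
  have hsuf : (ee v R x).drop R <:+ v y := by
    refine hT.long hS ?_ ?_ hyz
    · rw [h2]; exact List.drop_suffix _ _
    · rw [h2]; simp; omega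
  have hlt : (v y).length < (ee v R x).length := by
    by_contra hge
    have e1 : (ee v R y).length = (ee v R x).length := by
      have a1 := ee_len_lt v (R := R) (by omega) y
      have a2 := ee_len_le v R y
      rw [ee_len v R x, ee_len v R y] at *
      exact le_antisymm (mul_close (by omega)) (mul_close (by omega))
    have e2 := hT.persist hS (R := R) (j := 2 * k) (fun h => hy (h.mono hS (by omega))) hzy
    rw [h2] at e2
    have e3 := e2.eq_of_length e1
    exact hy ⟨e3 ▸ h1, z, e3 ▸ h2, h3, hS.pow_mono (by omega) hyz⟩
  symm
  refine ee_max v (m := (v x).length / R - 1) (by omega) y hsuf ?_ ?_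
  · rw [List.length_drop, ee_len, Nat.mul_sub, mul_one]
  · rw [List.length_drop]; omega

lemma IsTr.claimA (hT : IsTr v H A B t) (hS : GS S H t) {R k : ℕ} (hR : 10 * k < R) {x y : G}
    (hx : Near v t S R k x ∨ ¬ Near v t S R (4 * k) x)
    (hy : Near v t S R k y ∨ ¬ Near v t S R (4 * k) y) (hxy : x * y⁻¹ ∈ S ^ k) :
    qq v t S R k x = qq v t S R k y := by
  have hyx := hS.symm hxy
  have hi : ∀ {x}, ¬ Near v t S R (4 * k) x → ¬ Near v t S R k x :=
    fun h h' => h (h'.mono hS (by omega))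
  rcases hx with hx | hx <;> rcases hy with hy | hy
  · rw [qq, qq, if_pos hx, if_pos hy]
    obtain ⟨h1, z, h2, h3, h4⟩ := hx
    obtain ⟨h1', z', h2', h3', h4'⟩ := hy
    have hzz := GS.tri (3 * k) (hS.symm h4) (GS.tri (2 * k) hxy h4' (by omega)) (by omega)
    have hzz' := hS.symm hzz
    have l1 := hT.lip hS _ hzz
    have l2 := hT.lip hS _ hzz'
    rw [h2, h2'] at l1 l2
    have e1 : (ee v R x).length = (ee v R y).length := by
      rw [ee_len v R x, ee_len v R y] at *
      exact le_antisymm (mul_close (by omega)) (mul_close (by omega))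
    have hl0 : R ≤ (ee v R x).length := by
      have h5 : (ee v R x).length ≠ 0 := by simpa using h1
      rw [ee_len] at h5 ⊢
      refine Nat.le_mul_of_pos_right R (Nat.pos_of_ne_zero ?_)
      intro h; rw [h] at h5; simp at h5
    have hsuf : (ee v R x).drop R <:+ v z' := by
      refine hT.long hS ?_ ?_ hzz'
      · rw [h2]; exact List.drop_suffix _ _
      · rw [h2]; simp; omega
    rw [h2'] at hsuf
    exact suf_eq hsuf (List.drop_suffix _ _) (by simp [e1])
  · rw [qq, qq, if_pos hx, if_neg (hi hy)]
    exact hT.claimLH hS hR hx hy hxy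
  · rw [qq, qq, if_pos hy, if_neg (hi hx)]
    exact (hT.claimLH hS hR hy hx hyx).symm
  · rw [qq, qq, if_neg (hi hx), if_neg (hi hy)]
    have a1 := hT.persist hS (hi hx) hyx
    have a2 := hT.persist hS (hi hy) hxy
    have b1 := a1.length_le
    have b2 := a2.length_le
    have c1 := ee_len_lt v (R := R) (by omega) x
    have c2 := ee_len_lt v (R := R) (by omega) y
    refine suf_eq a1 (ee_suf _ _ _) ?_
    rw [ee_len v R x, ee_len v R y] at *
    exact le_antisymm (mul_close (by omega)) (mul_close (by omega))

open Classical in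
noncomputable def lay (v : G → List L) (t : G) (S : Set G) (R k : ℕ) (x : G) : Fin 3 :=
  if Near v t S R (2 * k) x then 0 else if Near v t S R (3 * k) x then 1 else 2

lemma lay_lt2 (hS : GS S H t) {R k : ℕ} {x : G} (h : lay v t S R k x < 2) :
    Near v t S R (3 * k) x := by
  unfold lay at h
  split_ifs at h with h1 h2
  · exact h1.mono hS (by omega)
  · exact h2
  · simp at h

lemma lay_gt0 {R k : ℕ} {x : G} (h : 0 < lay v t S R k x) :
    ¬ Near v t S R (2 * k) x := by
  intro h1
  rw [lay, if_pos h1] at h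
  simp at h

lemma lay_0 {R k : ℕ} {x : G} (h : lay v t S R k x = 0) :
    Near v t S R (2 * k) x := by
  unfold lay at h
  split_ifs at h with h1 h2
  · exact h1
  · simp at h
  · simp at h

lemma lay_2 {R k : ℕ} {x : G} (h : lay v t S R k x = 2) :
    ¬ Near v t S R (3 * k) x := by
  unfold lay at h
  split_ifs at h with h1 h2
  · simp at h
  · simp at h
  · exact h2

theorem IsTr.main (hT : IsTr v H A B t) (hH : AD 3 (H : Set G)) (hA : AD 2 (A : Set G))
    (hB : AD 2 (B : Set G)) : AD 3 (Set.univ : Set G) := by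
  classical
  intro K0 hK0
  obtain ⟨S, k, hS, hKS⟩ := hT.gs K0 hK0
  set K := S ^ k with hKdef
  have hK : K.Finite := hS.finpow k
  have hK1 : 1 ∈ K := Set.one_mem_pow hS.one
  obtain ⟨R, hR⟩ : ∃ R, 10 * k < R := ⟨10 * k + 1, by omega⟩
  -- base points
  have hbase : ∃ g : List L → G, ∀ l x, l <:+ v x → v (g l) = l := by
    have : ∀ l, ∃ g, (∃ x, l <:+ v x) → v g = l := by
      intro l
      by_cases h : ∃ x, l <:+ v x
      · obtain ⟨x, l', hx⟩ := h
        obtain ⟨g, hg⟩ := hT.real l l' x hx.symm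
        exact ⟨g, fun _ => hg⟩
      · exact ⟨1, fun h' => absurd h' h⟩
    choose g hg using this
    exact ⟨g, fun l x h => hg _ ⟨x, h⟩⟩
  obtain ⟨g, hg⟩ := hbase
  have hbase' : ∃ d : List L → G, ∀ x, Desc v t x → v (d (v x)) = v x ∧ Desc v t (d (v x)) := by
    have : ∀ l, ∃ g, (∃ x, v x = l ∧ Desc v t x) → v g = l ∧ Desc v t g := by
      intro l
      by_cases h : ∃ x, v x = l ∧ Desc v t x
      · obtain ⟨x, hx⟩ := h
        exact ⟨x, fun _ => hx⟩
      · exact ⟨1, fun h' => absurd h' h⟩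
    choose g hg using this
    exact ⟨g, fun x h => hg _ ⟨x, rfl, h⟩⟩
  obtain ⟨d, hd⟩ := hbase'
  -- edge colourings
  have kol : ∀ D : Subgroup G, AD 2 (D : Set G) → ∃ K' : Set G, K'.Finite ∧
      ∃ (m : Fin 3 → G → Prop) (b : Fin 3 → G → Set G),
      (∀ x ∈ S ^ (4 * k) * (D : Set G), ∀ i, ∃ j, j ≠ i ∧ m j x) ∧
      (∀ i, ∀ x ∈ S ^ (4 * k) * (D : Set G), ∀ y ∈ S ^ (4 * k) * (D : Set G),
        m i x → m i y → x * y⁻¹ ∈ K → b i x = b i y) ∧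
      (∀ i, ∀ x ∈ S ^ (4 * k) * (D : Set G), ∀ y ∈ S ^ (4 * k) * (D : Set G),
        m i x → m i y → b i x = b i y → x * y⁻¹ ∈ K') := fun D hD =>
    AD.kolm (AD.nbhd (hS.finpow (4 * k)) subset_rfl hD) K hK hK1 (hS.pow_inv k)
  obtain ⟨KA, hKA, mA, bA, A1, A2, A3⟩ := kol A hA
  obtain ⟨KB, hKB, mB, bB, B1, B2, B3⟩ := kol B hB
  have hKZ : (KA ∪ KB).Finite := hKA.union hKB
  set KZ := KA ∪ KB with hKZd
  let mid : G → Prop := fun x => ¬ Near v t S R k x ∧ Near v t S R (4 * k) x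
  have edge : ∀ l : List L, ∃ (m : Fin 3 → G → Prop) (b : Fin 3 → G → Set G),
      (∀ x, mid x → ee v R x = l → ∀ i, ∃ j, j ≠ i ∧ m j x) ∧
      (∀ i x y, mid x → mid y → ee v R x = l → ee v R y = l →
        m i x → m i y → x * y⁻¹ ∈ K → b i x = b i y) ∧
      (∀ i x y, mid x → mid y → ee v R x = l → ee v R y = l →
        m i x → m i y → b i x = b i y → x * y⁻¹ ∈ KZ) := by
    intro l
    have can : ∀ x y, x * (d l)⁻¹ * (y * (d l)⁻¹)⁻¹ = x * y⁻¹ := fun x y => by group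
    have gen : ∀ D : Subgroup G,
        (∀ x y, v x = l → v y = l → Desc v t x → Desc v t y → x * y⁻¹ ∈ D) →
        ∀ x, mid x → ee v R x = l → x * (d l)⁻¹ ∈ S ^ (4 * k) * (D : Set G) := by
      rintro D hD x ⟨_, _, y, h1, h2, h3⟩ rfl
      have h4 := hd y h2
      rw [h1] at h4
      exact ⟨_, h3, _, hD y _ h1 h4.1 h2 h4.2, by group⟩
    rcases hT.edge l with h | h
    · have key := gen A h
      refine ⟨fun i x => mA i (x * (d l)⁻¹), fun i x => bA i (x * (d l)⁻¹), ?_, ?_, ?_⟩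
      · exact fun x hx hl i => A1 _ (key x hx hl) i
      · exact fun i x y hx hy hlx hly hmx hmy hk =>
          A2 i _ (key x hx hlx) _ (key y hy hly) hmx hmy (by rw [can]; exact hk)
      · intro i x y hx hy hlx hly hmx hmy hb
        have := A3 i _ (key x hx hlx) _ (key y hy hly) hmx hmy hb
        rw [can] at this
        exact Or.inl this
    · have key := gen B h
      refine ⟨fun i x => mB i (x * (d l)⁻¹), fun i x => bB i (x * (d l)⁻¹), ?_, ?_, ?_⟩
      · exact fun x hx hl i => B1 _ (key x hx hl) i
      · exact fun i x y hx hy hlx hly hmx hmy hk =>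
          B2 i _ (key x hx hlx) _ (key y hy hly) hmx hmy (by rw [can]; exact hk)
      · intro i x y hx hy hlx hly hmx hmy hb
        have := B3 i _ (key x hx hlx) _ (key y hy hly) hmx hmy hb
        rw [can] at this
        exact Or.inr this
  choose m b e1 e2 e3 using edge
  -- colour of mid points
  have hcz : ∀ x, ∃ j, mid x → j ≠ lay v t S R k x ∧ m (ee v R x) j x := by
    intro x
    by_cases hx : mid x
    · obtain ⟨j, hj⟩ := e1 _ x hx rfl (lay v t S R k x)
      exact ⟨j, fun _ => hj⟩
    · exact ⟨0, fun h => absurd h hx⟩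
  choose cZ hcZ using hcz
  obtain ⟨KY, hKY, cP, bP, P1, P2⟩ := hT.ball hH (2 * R) (K ∪ K * KZ * K)
    (hK.union ((hK.mul hKZ).mul hK))
  let q := qq v t S R k
  have hqsuf : ∀ x, q x <:+ v x := by
    intro x
    simp only [q, qq]
    split_ifs
    · exact (List.drop_suffix _ _).trans (ee_suf _ _ _)
    · exact ee_suf _ _ _
  have hqP : ∀ x, x * (g (q x))⁻¹ ∈ {x | (v x).length ≤ 2 * R} := by
    intro x
    obtain ⟨l', hl'⟩ := hqsuf x
    have h1 := hg _ x (hqsuf x)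
    have h2 := hT.rel l' (x := x) (g := g (q x)) (by rw [h1, hl'])
    refine h2.trans ?_
    have h3 := congrArg List.length hl'
    rw [List.length_append] at h3
    have h4 := ee_len_lt v (R := R) (by omega) x
    have h5 : (ee v R x).length ≤ (q x).length + R := by
      simp only [q, qq]
      split_ifs
      · rw [List.length_drop]; omega
      · omega
    omega
  let c : G → Fin 3 := fun x => if mid x then cZ x else cP (x * (g (q x))⁻¹)
  have cin : ∀ x, ¬ mid x → c x = cP (x * (g (q x))⁻¹) := fun x hx => if_neg hx
  have cout : ∀ x, mid x → c x = cZ x := fun x hx => if_pos hx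
  have nonmid : ∀ x, ¬ mid x → Near v t S R k x ∨ ¬ Near v t S R (4 * k) x := by
    intro x hx
    by_contra h
    push Not at h
    exact hx h
  let bZ : G → List L × Fin 3 × Prop × Set G := fun x =>
    (ee v R x, cZ x, lay v t S R k x < cZ x, b (ee v R x) (cZ x) x)
  have hmem : ∀ x, x ∉ {x | ¬ mid x} → mid x := fun x hx => not_not.1 hx
  have hbY : ∀ x y, q x = q y → c x = c y → ¬ mid x → ¬ mid y → x * y⁻¹ ∈ K ∪ K * KZ * K →
      (q x, bP (x * (g (q x))⁻¹)) = (q y, bP (y * (g (q y))⁻¹)) := by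
    intro x y hq hc hx hy hk
    rw [cin x hx, cin y hy] at hc
    refine Prod.ext hq ?_
    simp only
    refine P1 _ (hqP x) _ (hqP y) hc ?_
    have : x * (g (q x))⁻¹ * (y * (g (q y))⁻¹)⁻¹ = x * y⁻¹ := by rw [hq]; group
    rw [this]; exact hk
  have hbZ' : ∀ x y, mid x → mid y → bZ x = bZ y → x * y⁻¹ ∈ KZ := by
    intro x y hx hy hb
    simp only [bZ, Prod.mk.injEq] at hb
    obtain ⟨b1, b2, b3, b4⟩ := hb
    rw [← b1, ← b2] at b4
    refine e3 (ee v R x) (cZ x) x y hx hy rfl b1.symm (hcZ x hx).2 ?_ b4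
    have := (hcZ y hy).2
    rwa [← b1, ← b2] at this
  have side1 : ∀ z x, mid z → ¬ mid x → x * z⁻¹ ∈ K → lay v t S R k z < cZ z →
      ee v R x = ee v R z ∧ Near v t S R k x := by
    intro z x hz hx hk hl
    have he := hT.claimB hS hR hz.1 hz.2 (hS.symm hk)
    refine ⟨he, ?_⟩
    have h2 : lay v t S R k z < 2 := lt_of_lt_of_le hl (Fin.le_last _)
    have h3 := (lay_lt2 hS h2).trans (4 * k) he hk (by omega)
    exact (nonmid x hx).resolve_right (fun h => h h3)
  have side2 : ∀ z x, mid z → ¬ mid x → x * z⁻¹ ∈ K → ¬ lay v t S R k z < cZ z →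
      ee v R x = ee v R z ∧ ¬ Near v t S R k x := by
    intro z x hz hx hk hl
    have he := hT.claimB hS hR hz.1 hz.2 (hS.symm hk)
    refine ⟨he, ?_⟩
    have hne := (hcZ z hz).1
    have h2 : 0 < lay v t S R k z :=
      lt_of_le_of_lt (Fin.zero_le _) (lt_of_le_of_ne (not_lt.1 hl) hne)
    intro hn
    exact lay_gt0 h2 (hn.trans (2 * k) he.symm (hS.symm hk) (by omega))
  refine Exists.elim (absorb (n := 3) K Set.univ {x | ¬ mid x} KZ KY hK (hS.pow_inv k) hKZ hKY c bZ
    (fun x => (q x, bP (x * (g (q x))⁻¹))) ?_ ?_ ?_ ?_ ?_) ?_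
  · intro x _ y _ hx hy hc hk
    replace hx := hmem x hx
    replace hy := hmem y hy
    rw [cout x hx, cout y hy] at hc
    have he := hT.claimB hS hR hx.1 hx.2 hk
    have hcx := hcZ x hx
    have hcy := hcZ y hy
    rw [← hc] at hcy
    have lem : ∀ x y, ee v R y = ee v R x → x * y⁻¹ ∈ K → ∀ j, j ≠ lay v t S R k x →
        j ≠ lay v t S R k y → lay v t S R k x < j → lay v t S R k y < j := by
      intro x y he hk j h1 h2 h3
      by_contra h4
      have h5 : lay v t S R k x = 0 ∧ lay v t S R k y = 2 := by omega
      exact lay_2 h5.2 ((lay_0 h5.1).trans (3 * k) he (hS.symm hk) (by omega))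
    simp only [bZ, Prod.mk.injEq]
    refine ⟨he.symm, hc, ?_, ?_⟩
    · rw [← hc]
      exact propext ⟨lem x y he hk _ hcx.1 hcy.1, lem y x he.symm (hS.symm hk) _ hcy.1 hcx.1⟩
    · rw [← hc, he]
      refine e2 _ _ x y hx hy rfl he hcx.2 ?_ hk
      rw [← he]; exact hcy.2
  · exact fun x _ y _ hx hy hb => hbZ' x y (hmem x hx) (hmem y hy) hb
  · intro x _ y _ hx hy hc hk
    exact hbY x y (hT.claimA hS hR (nonmid x hx) (nonmid y hy) hk) hc hx hy (Or.inl hk)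
  · intro x _ y _ hx hy z _ w _ hz hw hc hc1 hc2 hk hb hk2
    replace hz := hmem z hz
    replace hw := hmem w hw
    have hzw := hbZ' z w hz hw hb
    refine hbY x y ?_ hc hx hy (Or.inr ⟨_, ⟨_, hk, _, hzw, rfl⟩, _, hk2, by group⟩)
    simp only [bZ, Prod.mk.injEq] at hb
    obtain ⟨b1, b2, b3, b4⟩ := hb
    by_cases hl : lay v t S R k z < cZ z
    · obtain ⟨x1, x2⟩ := side1 z x hz hx hk hl
      obtain ⟨y1, y2⟩ := side1 w y hw hy (hS.symm hk2) (b3 ▸ hl)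
      simp only [q, qq]
      rw [if_pos x2, if_pos y2, x1, y1, b1]
    · obtain ⟨x1, x2⟩ := side2 z x hz hx hk hl
      obtain ⟨y1, y2⟩ := side2 w y hw hy (hS.symm hk2) (b3 ▸ hl)
      simp only [q, qq]
      rw [if_neg x2, if_neg y2, x1, y1, b1]
  · intro x _ y _ hx hy hb
    obtain ⟨h1, h2⟩ := Prod.ext_iff.1 hb
    simp only at h1 h2
    have := P2 _ (hqP x) _ (hqP y) h2
    have h3 : x * (g (q x))⁻¹ * (y * (g (q y))⁻¹)⁻¹ = x * y⁻¹ := by rw [h1]; group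
    rwa [h3] at this
  · rintro K' ⟨hK', b, hb1, hb2⟩
    exact ⟨K', hK', c, b, fun x hx y hy hc h => hb1 x hx y hy hc (hKS h), hb2⟩

end
end ORG

namespace ORG
open Pointwise

section
open HNNExtension HNNExtension.NormalWord
variable {G : Type} [Group G] {A B : Subgroup G} {φ : A ≃* B} {d : TransversalPair G A B}

lemma usm_cancel (u : ℤˣ) (w : NormalWord d) (h : Cancels u w) :
    ∃ a, w.toList = a :: (unitsSMul φ u w).toList := by
  rw [unitsSMul, dif_pos h]
  cases w using consRecOn with
  | ofGroup => simp [Cancels] at h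
  | cons g u' w h1 h2 ih =>
    exact ⟨_, rfl⟩

lemma usm_not (u : ℤˣ) (w : NormalWord d) (h : ¬ Cancels u w) :
    ∃ a, (unitsSMul φ u w).toList = a :: w.toList := by
  rw [unitsSMul, dif_neg h]
  exact ⟨_, rfl⟩

noncomputable def vv (φ : A ≃* B) (d : TransversalPair G A B) (x : HNNExtension G A B φ) :
    List (ℤˣ × G) := (x • (empty : NormalWord d)).toList

lemma tpm (s : HNNExtension G A B φ) (hs : s = t ∨ s = t⁻¹) : ∃ u : ℤˣ, s = t ^ (u : ℤ) := by
  rcases hs with h | h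
  · exact ⟨1, by simp [h]⟩
  · exact ⟨-1, by simp [h]⟩

lemma tpm' (u : ℤˣ) : (t ^ (u : ℤ) : HNNExtension G A B φ) = t ∨
    (t ^ (u : ℤ) : HNNExtension G A B φ) = t⁻¹ := by
  rcases Int.units_eq_one_or u with rfl | rfl <;> simp

lemma vv_fib (x y : HNNExtension G A B φ) (h : vv φ d x = vv φ d y) :
    x * y⁻¹ = of ((x • (empty : NormalWord d)).head * (y • (empty : NormalWord d)).head⁻¹) := by
  have hx : x = ((x • (empty : NormalWord d))).prod φ := by simp
  have hy : y = ((y • (empty : NormalWord d))).prod φ := by simp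
  rw [vv, vv] at h
  conv_lhs => rw [hx, hy]
  simp only [ReducedWord.prod, h, mul_inv_rev, map_mul, map_inv]
  group

theorem hnn_isTr (φ : A ≃* B) (d : TransversalPair G A B) :
    IsTr (vv φ d) (of (φ := φ)).range (A.map of) (B.map of) t where
  one := by simp [vv]
  inv := by
    rintro _ ⟨h, rfl⟩ x
    simp [vv, mul_smul, of_smul_eq_smul]
  fib := by
    intro x y h
    exact ⟨_, (vv_fib x y h).symm⟩
  step := by
    intro s hs x
    obtain ⟨u, rfl⟩ := tpm s hs
    simp only [vv, mul_smul, t_pow_smul_eq_unitsSMul]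
    by_cases h : Cancels u (x • (empty : NormalWord d))
    · exact Or.inr (usm_cancel u _ h)
    · exact Or.inl (usm_not u _ h)
  down := by
    intro x a l h
    refine ⟨t ^ ((-a.1 : ℤˣ) : ℤ), tpm' _, of ((x • (empty : NormalWord d)).head⁻¹),
      ⟨_, rfl⟩, ?_⟩
    simp only [vv] at h
    simp only [vv, mul_smul, t_pow_smul_eq_unitsSMul, of_smul_eq_smul]
    have hc : Cancels (-a.1) ((x • (empty : NormalWord d)).head⁻¹ • (x • (empty : NormalWord d))) := by
      simp only [Cancels, group_smul_head, inv_mul_cancel, group_smul_toList, h]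
      exact ⟨one_mem _, by simp⟩
    obtain ⟨b, hb⟩ := usm_cancel (φ := φ) _ _ hc
    rw [group_smul_toList, h] at hb
    exact (List.cons_eq_cons.1 hb).2.symm
  edge := by
    have key : ∀ l : List (ℤˣ × G), ∃ u : ℤˣ, ∀ x, vv φ d x = l → Desc (vv φ d) t x →
        (x • (empty : NormalWord d)).head ∈ toSubgroup A B u := by
      intro l
      cases l with
      | nil =>
        refine ⟨1, ?_⟩
        rintro x hx ⟨s, hs, a, h⟩
        rw [hx] at h
        cases h
      | cons b l =>
        refine ⟨-b.1, ?_⟩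
        rintro x hx ⟨s, hs, a, h⟩
        obtain ⟨u, rfl⟩ := tpm s hs
        have hc : Cancels u (x • (empty : NormalWord d)) := by
          by_contra hc
          obtain ⟨c, hc⟩ := usm_not (φ := φ) u _ hc
          simp only [vv, mul_smul, t_pow_smul_eq_unitsSMul] at h
          rw [hc] at h
          have := congrArg List.length h
          simp at this
          omega
        have h2 := hc.2
        rw [vv] at hx
        rw [hx] at h2
        simp only [List.head?_cons, Option.map_some, Option.some.injEq] at h2
        rw [h2, neg_neg]
        exact hc.1
    intro l
    obtain ⟨u, hu⟩ := key l
    rcases Int.units_eq_one_or u with rfl | rfl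
    · left
      intro x y hx hy dx dy
      rw [vv_fib x y (hx.trans hy.symm)]
      exact ⟨_, A.mul_mem (hu x hx dx) (A.inv_mem (hu y hy dy)), rfl⟩
    · right
      intro x y hx hy dx dy
      rw [vv_fib x y (hx.trans hy.symm)]
      exact ⟨_, B.mul_mem (hu x hx dx) (B.inv_mem (hu y hy dy)), rfl⟩
  gen := by
    rw [eq_top_iff]
    intro x _
    induction x using induction_on with
    | of g => exact Subgroup.subset_closure (Or.inl ⟨g, rfl⟩)
    | t => exact Subgroup.subset_closure (Or.inr rfl)
    | mul x y hx hy => exact mul_mem (hx trivial) (hy trivial)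
    | inv x hx => exact inv_mem (hx trivial)

theorem hnn_AD {F F' : Type} [Group F] [Group F'] (f : F →* G) (f' : F' →* G)
    (hf : Function.Injective f) (hf' : Function.Injective f') (φ : f.range ≃* f'.range)
    (hG : AD 3 (Set.univ : Set G)) (hA : AD 2 (Set.univ : Set F)) (hB : AD 2 (Set.univ : Set F')) :
    AD 3 (Set.univ : Set (HNNExtension G f.range f'.range φ)) := by
  obtain ⟨d⟩ := TransversalPair.nonempty G f.range f'.range
  have inj : Function.Injective (of (φ := φ)) := of_injective φ
  refine (hnn_isTr φ d).main (AD.of_range _ inj hG) ?_ ?_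
  · rw [MonoidHom.map_range]
    exact AD.of_range _ (inj.comp hf) hA
  · rw [MonoidHom.map_range]
    exact AD.of_range _ (inj.comp hf') hB

end
end ORG

namespace ORG
open Pointwise

lemma AD.local {G : Type} [Group G] {n : ℕ}
    (h : ∀ K : Set G, K.Finite → ∃ D : Subgroup G, K ⊆ D ∧ AD n (D : Set G)) :
    AD n (Set.univ : Set G) := by
  classical
  intro K hK
  obtain ⟨D, hKD, hD⟩ := h K hK
  obtain ⟨K', hK', c, b, h1, h2⟩ := hD K hK
  let s : Setoid G := ⟨fun x y => x * y⁻¹ ∈ D, fun x => by simp [D.one_mem], fun {x y} h => by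
    simpa using D.inv_mem h, fun {x y z} h h' => by simpa using D.mul_mem h h'⟩
  let g : G → G := fun x => (Quotient.mk s x).out
  have hg : ∀ x, x * (g x)⁻¹ ∈ D := fun x => s.symm (Quotient.mk_out (s := s) x)
  have hg' : ∀ x y, x * y⁻¹ ∈ D → g x = g y := fun x y h => by
    simp only [g]
    rw [Quotient.sound (s := s) (a := x) (b := y) h]
  have can : ∀ x y, g x = g y → x * (g x)⁻¹ * (y * (g y)⁻¹)⁻¹ = x * y⁻¹ := by
    intro x y h
    rw [h]; group
  obtain ⟨b', hb'⟩ := lab (fun x => (g x, b (x * (g x)⁻¹)))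
  refine ⟨K', hK', fun x => c (x * (g x)⁻¹), b', ?_, ?_⟩
  · intro x _ y _ hc hk
    rw [hb']
    have h3 := hg' x y (hKD hk)
    refine Prod.ext h3 (h1 _ (hg x) _ (hg y) hc ?_)
    rw [can x y h3]
    exact hk
  · intro x _ y _ hb
    rw [hb'] at hb
    obtain ⟨h3, h4⟩ := Prod.ext_iff.1 hb
    have := h2 _ (hg x) _ (hg y) h4
    rwa [can x y h3] at this

lemma fg_step {α : Type} [DecidableEq α] (p : α × Bool) (x : FreeGroup α) :
    (FreeGroup.mk [p] * x).toWord = p :: x.toWord ∨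
      ∃ q, x.toWord = q :: (FreeGroup.mk [p] * x).toWord := by
  have h : (FreeGroup.mk [p] * x).toWord = FreeGroup.reduce (p :: x.toWord) := by
    conv_lhs => rw [← FreeGroup.mk_toWord (x := x)]
    rw [FreeGroup.mul_mk, FreeGroup.toWord_mk, List.singleton_append]
  rw [h, FreeGroup.reduce.cons, FreeGroup.reduce_toWord]
  cases hx : x.toWord with
  | nil => left; rfl
  | cons q l =>
    simp only
    split_ifs
    · right; exact ⟨q, rfl⟩
    · left; rfl

lemma fg_suf {α : Type} [DecidableEq α] (y : FreeGroup α) (l : List (α × Bool))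
    (hl : l <:+ y.toWord) (w : List (α × Bool)) : l.length + w.length ≤ y.toWord.length →
      l <:+ (FreeGroup.mk w * y).toWord ∧
      y.toWord.length ≤ (FreeGroup.mk w * y).toWord.length + w.length := by
  induction w with
  | nil =>
    intro _
    rw [← FreeGroup.one_eq_mk, one_mul]
    exact ⟨hl, by simp⟩
  | cons p w ih =>
    intro h
    simp only [List.length_cons] at h
    obtain ⟨h1, h2⟩ := ih (by omega)
    have h3 : FreeGroup.mk (p :: w) * y = FreeGroup.mk [p] * (FreeGroup.mk w * y) := by
      rw [← mul_assoc, FreeGroup.mul_mk, List.singleton_append]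
    rw [h3]
    rcases fg_step p (FreeGroup.mk w * y) with h4 | ⟨q, h4⟩
    · rw [h4]
      exact ⟨h1.trans (List.suffix_cons _ _), by simp; omega⟩
    · have h5 := congrArg List.length h4
      simp only [List.length_cons] at h5 ⊢
      refine ⟨?_, by omega⟩
      rw [h4, List.suffix_cons_iff] at h1
      rcases h1 with h1 | h1
      · rw [h1] at h
        simp only [List.length_cons] at h
        omega
      · exact h1

lemma free_fin {α : Type} [Finite α] : AD 2 (Set.univ : Set (FreeGroup α)) := by
  classical
  intro K hK
  obtain ⟨k, hk⟩ : ∃ k, ∀ x ∈ K, x.norm ≤ k := by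
    obtain ⟨k, hk⟩ := (hK.image FreeGroup.norm).bddAbove
    exact ⟨k, fun x hx => hk ⟨x, hx, rfl⟩⟩
  let v : FreeGroup α → List (α × Bool) := FreeGroup.toWord
  set R := k + 1 with hR
  have hRp : 0 < R := by omega
  have lip : ∀ x y, x * y⁻¹ ∈ K → (v x).length ≤ (v y).length + k := by
    intro x y h
    have := FreeGroup.norm_mul_le (x * y⁻¹) y
    rw [inv_mul_cancel_right] at this
    have h2 := hk _ h
    simp only [FreeGroup.norm] at this h2
    simp only [v]
    omega
  have lip' : ∀ x y, x * y⁻¹ ∈ K → (v y).length ≤ (v x).length + k := by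
    intro x y h
    have := FreeGroup.norm_mul_le (x * y⁻¹)⁻¹ x
    rw [FreeGroup.norm_inv_eq, mul_inv_rev, inv_inv, inv_mul_cancel_right] at this
    have h2 := hk _ h
    simp only [FreeGroup.norm] at this h2
    simp only [v]
    omega
  let l : FreeGroup α → List (α × Bool) := fun x => (ee v R x).drop R
  have lsuf : ∀ x, l x <:+ v x := fun x => (List.drop_suffix _ _).trans (ee_suf _ _ _)
  obtain ⟨b, hb⟩ := lab l
  let c : FreeGroup α → Fin 2 := fun x => ⟨(v x).length / R % 2, Nat.mod_lt _ (by omega)⟩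
  let W : Set (FreeGroup α) := FreeGroup.mk '' {l | l.length < 2 * R}
  have hW : W.Finite := (List.finite_length_lt _ _).image _
  refine ⟨W * W⁻¹, hW.mul hW.inv, c, b, ?_, ?_⟩
  · intro x _ y _ hc h
    rw [hb]
    have hc' : (v x).length / R % 2 = (v y).length / R % 2 := congrArg Fin.val hc
    have l1 := lip x y h
    have l2 := lip' x y h
    have hm : (v x).length / R = (v y).length / R := by
      have a1 : (v x).length / R ≤ (v y).length / R + 1 := by
        rw [← Nat.add_div_right _ hRp]
        exact Nat.div_le_div_right (by omega)
      have a2 : (v y).length / R ≤ (v x).length / R + 1 := by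
        rw [← Nat.add_div_right _ hRp]
        exact Nat.div_le_div_right (by omega)
      omega
    have hlen : (l x).length = (l y).length := by
      simp only [l, List.length_drop, ee_len, hm]
    refine suf_eq ?_ (lsuf y) hlen
    by_cases h0 : l x = []
    · rw [h0]; exact List.nil_suffix
    · have h4 : (l x).length ≠ 0 := by simpa using h0
      have h5 : (l x).length = (ee v R x).length - R := by simp [l]
      have h6 := ee_len_le v R x
      have h7 : (y * x⁻¹) ⁻¹ ∈ K := by simpa using h
      have h8 := hk _ h7
      rw [FreeGroup.norm_inv_eq] at h8
      have h9 := fg_suf x (l x) (lsuf x) (y * x⁻¹).toWord (by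
        simp only [FreeGroup.norm] at h8
        change _ ≤ x.toWord.length at h6
        omega)
      rw [FreeGroup.mk_toWord, inv_mul_cancel_right] at h9
      exact h9.1
  · intro x _ y _ h
    rw [hb] at h
    have key : ∀ x, x * (FreeGroup.mk (l x))⁻¹ ∈ W := by
      intro x
      obtain ⟨l1, h1⟩ := lsuf x
      refine ⟨l1, ?_, ?_⟩
      · have h2 := congrArg List.length h1
        rw [List.length_append] at h2
        have h3 := ee_len_lt v hRp x
        have h5 : (l x).length = (ee v R x).length - R := by simp [l]
        change l1.length < 2 * R
        omega
      · rw [eq_mul_inv_iff_mul_eq, FreeGroup.mul_mk, h1]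
        exact FreeGroup.mk_toWord
    refine ⟨_, key x, _, Set.inv_mem_inv.2 (key y), ?_⟩
    simp only
    rw [h]; group

lemma fg_mem_range {α : Type} (s : Set α) (x : FreeGroup α) (w : List (α × Bool))
    (hw : x = FreeGroup.mk w) (h : ∀ p ∈ w, p.1 ∈ s) :
    x ∈ (FreeGroup.map (Subtype.val : s → α)).range := by
  subst hw
  induction w with
  | nil => rw [← FreeGroup.one_eq_mk]; exact one_mem _
  | cons p w ih =>
    have : FreeGroup.mk (p :: w) = FreeGroup.mk [p] * FreeGroup.mk w := by
      rw [FreeGroup.mul_mk, List.singleton_append]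
    rw [this]
    refine mul_mem ?_ (ih (fun q hq => h q (List.mem_cons_of_mem _ hq)))
    exact ⟨FreeGroup.mk [(⟨p.1, h p List.mem_cons_self⟩, p.2)], by simp⟩

lemma fg_map_inj {α β : Type} {f : α → β} (hf : Function.Injective f) :
    Function.Injective (FreeGroup.map f) := by
  classical
  by_cases hα : Nonempty α
  · obtain ⟨g, hg⟩ := hf.hasLeftInverse
    apply Function.LeftInverse.injective (g := FreeGroup.map g)
    intro x
    rw [FreeGroup.map.comp, hg.comp_eq_id, FreeGroup.map.id]
  · have : IsEmpty α := not_nonempty_iff.1 hα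
    exact Function.injective_of_subsingleton _

theorem free_AD {α : Type} : AD 2 (Set.univ : Set (FreeGroup α)) := by
  classical
  refine AD.local fun K hK => ?_
  have hfin : (⋃ x ∈ K, {a | ∃ p ∈ x.toWord, p.1 = a}).Finite := by
    refine hK.biUnion fun x _ => ?_
    refine Set.Finite.subset ((x.toWord.map Prod.fst).toFinset.finite_toSet) ?_
    rintro a ⟨p, hp, rfl⟩
    simp only [List.coe_toFinset, List.mem_map]
    exact ⟨p, hp, rfl⟩
  set s : Set α := ⋃ x ∈ K, {a | ∃ p ∈ x.toWord, p.1 = a}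
  have : Finite s := hfin
  refine ⟨(FreeGroup.map (Subtype.val : s → α)).range, ?_,
    AD.of_range _ (fg_map_inj Subtype.val_injective) free_fin⟩
  intro x hx
  refine fg_mem_range s x x.toWord FreeGroup.mk_toWord.symm ?_
  intro p hp
  exact Set.mem_biUnion hx ⟨p, hp, rfl⟩

end ORG

namespace ORG
open Pointwise

lemma wb_mono {G : Type} [Group G] (S : Set G) {m n : ℕ} (h : m ≤ n) (g : G) :
    wordBall S m g ⊆ wordBall S n g := by
  rintro x ⟨w, h1, h2, h3⟩
  exact ⟨w, h1.trans h, h2, h3⟩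

lemma wb_fin {G : Type} [Group G] (S : Finset G) (n : ℕ) : (wordBall (S : Set G) n 1).Finite := by
  classical
  have hT : ((S : Set G) ∪ (S : Set G)⁻¹).Finite := S.finite_toSet.union S.finite_toSet.inv
  set T := (S : Set G) ∪ (S : Set G)⁻¹
  have : Finite T := hT
  refine Set.Finite.subset ((List.finite_length_le T n).image
    (fun l => (l.map Subtype.val).prod)) ?_
  rintro x ⟨w, h1, h2, rfl⟩
  have h2' : ∀ x ∈ w, x ∈ T := fun x hx => h2 x hx
  lift w to List T using h2'
  exact ⟨w, by simpa using h1, by simp⟩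

lemma wb_cover {G : Type} [Group G] (S : Finset G) (hS : Subgroup.closure (S : Set G) = ⊤) (g : G) :
    ∃ n, g ∈ wordBall (S : Set G) n 1 := by
  have hg : g ∈ Subgroup.closure (S : Set G) := by rw [hS]; trivial
  rw [← Subgroup.mem_toSubmonoid, Subgroup.closure_toSubmonoid] at hg
  obtain ⟨l, hl, h⟩ := Submonoid.exists_list_of_mem_closure hg
  exact ⟨l.length, l, le_rfl, hl, by simp [h]⟩

theorem asdimLE_of_AD {G : Type} [Group G] (h : AD 3 (Set.univ : Set G)) : AsdimLE G 2 := by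
  classical
  intro S hS R
  obtain ⟨K', hK', c, b, h1, h2⟩ := h (wordBall (S : Set G) (2 * R) 1) (wb_fin S _)
  let blk : G → Set G := fun x => {y | c y⁻¹ = c x⁻¹ ∧ b y⁻¹ = b x⁻¹}
  have hblk : ∀ x y, y ∈ blk x → blk y = blk x := by
    rintro x y ⟨h1, h2⟩
    ext z
    change (_ ∧ _) ↔ (_ ∧ _)
    rw [h1, h2]
  refine ⟨Set.range blk, ?_, ?_, ?_⟩
  · rw [Set.eq_univ_iff_forall]
    exact fun x => ⟨blk x, ⟨x, rfl⟩, rfl, rfl⟩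
  · choose n hn using wb_cover S hS
    obtain ⟨B, hB⟩ := (hK'.image n).bddAbove
    refine ⟨B, ?_⟩
    rintro _ ⟨z, rfl⟩ x hx y hy
    have h3 := h2 x⁻¹ trivial y⁻¹ trivial (hx.2.trans hy.2.symm)
    obtain ⟨w, w1, w2, w3⟩ := wb_mono (S : Set G) (hB ⟨_, h3, rfl⟩) 1 (hn _)
    refine ⟨w, w1, w2, ?_⟩
    rw [one_mul] at w3
    rw [← w3]; group
  · intro g
    have key : ∀ U ∈ {U ∈ Set.range blk | (wordBall (S : Set G) R g ∩ U).Nonempty},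
        ∃ x, x ∈ wordBall (S : Set G) R g ∧ U = blk x := by
      rintro U ⟨⟨z, rfl⟩, x, hx, hx'⟩
      exact ⟨x, hx, (hblk z x hx').symm⟩
    choose p hp1 hp2 using key
    let F : {U ∈ Set.range blk | (wordBall (S : Set G) R g ∩ U).Nonempty} → Fin 3 :=
      fun U => c (p U.1 U.2)⁻¹
    have hF : Function.Injective F := by
      rintro ⟨U, hU⟩ ⟨V, hV⟩ hUV
      obtain ⟨w, w1, w2, w3⟩ := hp1 U hU
      obtain ⟨w', w1', w2', w3'⟩ := hp1 V hV
      have hc : c (p U hU)⁻¹ = c (p V hV)⁻¹ := hUV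
      have hb := h1 _ trivial _ trivial hc ⟨(w.map (·⁻¹)).reverse ++ w', by simp; omega, ?_, ?_⟩
      · apply Subtype.ext
        simp only
        rw [hp2 U hU, hp2 V hV]
        exact hblk _ _ ⟨hc, hb⟩
      · intro x hx
        rw [List.mem_append, List.mem_reverse, List.mem_map] at hx
        rcases hx with ⟨y, hy, rfl⟩ | hx
        · rw [inv_inv]; exact (w2 y hy).symm
        · exact w2' x hx
      · rw [w3, w3', List.prod_append, ← List.prod_inv_reverse]; group
    have hfin : Finite ↑{U ∈ Set.range blk | (wordBall (S : Set G) R g ∩ U).Nonempty} :=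
      Finite.of_injective F hF
    refine ⟨hfin, ?_⟩
    have := Nat.card_le_card_of_injective F hF
    simpa using this

theorem asdim_le_of_AD {G : Type} [Group G] (h : AD 3 (Set.univ : Set G)) : asdim G ≤ 2 :=
  sInf_le ⟨2, asdimLE_of_AD h, rfl⟩

end ORG

namespace ORG
open Pointwise
open Classical

abbrev PG {α : Type} (r : FreeGroup α) : Type := PresentedGroup ({r} : Set (FreeGroup α))

abbrev pm {α : Type} (r : FreeGroup α) : FreeGroup α →* PG r := PresentedGroup.mk {r}

lemma pm_self {α : Type} (r : FreeGroup α) : pm r r = 1 :=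
  PresentedGroup.one_of_mem (rels := {r}) rfl

lemma pm_surj {α : Type} (r : FreeGroup α) : Function.Surjective (pm r) :=
  PresentedGroup.mk_surjective _

lemma pm_lift {α : Type} {G : Type} [Group G] (r : FreeGroup α) (f : FreeGroup α →* G)
    (h : f r = 1) : ∃ g : PG r →* G, ∀ w, g (pm r w) = f w := by
  have h1 : Subgroup.normalClosure ({r} : Set (FreeGroup α)) ≤ f.ker := by
    apply Subgroup.normalClosure_le_normal
    rintro x rfl
    exact h
  exact ⟨QuotientGroup.lift _ f h1, fun w => rfl⟩

/-- conjugate relators -/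
lemma pm_conj {α : Type} {r s : FreeGroup α} (h : IsConj r s) : pm r s = 1 := by
  have := (pm r).map_isConj h
  rw [pm_self] at this
  exact (isConj_one_right.1 this)

lemma PG_conj_inj {α : Type} {r s : FreeGroup α} (h : IsConj r s) :
    ∃ g : PG r →* PG s, Function.Injective g := by
  obtain ⟨g, hg⟩ := pm_lift r (pm s) (pm_conj h.symm)
  obtain ⟨g', hg'⟩ := pm_lift s (pm r) (pm_conj h)
  refine ⟨g, Function.LeftInverse.injective (g := g') ?_⟩
  intro x
  obtain ⟨w, rfl⟩ := pm_surj r x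
  rw [hg, hg']

noncomputable def kill {α : Type} (x : α) : FreeGroup α →* FreeGroup α :=
  FreeGroup.lift (fun y => if y = x then 1 else FreeGroup.of y)

def Ess {α : Type} (r : FreeGroup α) (x : α) : Prop := ¬ IsConj r (kill x r)

def FS {α : Type} (r : FreeGroup α) (x : α) : Prop :=
  ∀ w : FreeGroup α, kill x w = w → pm r w = 1 → w = 1

lemma mk_cons {α : Type} (p : α × Bool) (L : List (α × Bool)) :
    FreeGroup.mk (p :: L) = FreeGroup.mk [p] * FreeGroup.mk L := by
  rw [FreeGroup.mul_mk, List.singleton_append]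

lemma mk_single_true {α : Type} (a : α) : FreeGroup.mk [(a, true)] = FreeGroup.of a := rfl

lemma mk_single_false {α : Type} (a : α) : FreeGroup.mk [(a, false)] = (FreeGroup.of a)⁻¹ := by
  rw [FreeGroup.of, FreeGroup.inv_mk]; rfl

lemma hom_single {α : Type} {G : Type} [Group G] (f g : FreeGroup α →* G) (a : α × Bool)
    (h : f (FreeGroup.of a.1) = g (FreeGroup.of a.1)) :
    f (FreeGroup.mk [a]) = g (FreeGroup.mk [a]) := by
  obtain ⟨a, b⟩ := a
  cases b
  · rw [mk_single_false, map_inv, map_inv, h]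
  · exact h

/-- homs agreeing on letters of a word -/
lemma hom_list {α : Type} {G : Type} [Group G] (f g : FreeGroup α →* G) (L : List (α × Bool))
    (h : ∀ p ∈ L, f (FreeGroup.of p.1) = g (FreeGroup.of p.1)) :
    f (FreeGroup.mk L) = g (FreeGroup.mk L) := by
  induction L with
  | nil => rw [← FreeGroup.one_eq_mk, map_one, map_one]
  | cons p L ih =>
    rw [mk_cons, map_mul, map_mul, ih (fun q hq => h q (List.mem_cons_of_mem _ hq)),
      hom_single f g p (h p List.mem_cons_self)]

lemma kill_of_ne {α : Type} {x y : α} (h : y ≠ x) : kill x (FreeGroup.of y) = FreeGroup.of y := by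
  simp [kill, h]

lemma kill_self {α : Type} (x : α) : kill x (FreeGroup.of x) = 1 := by
  simp [kill]

lemma kill_mk {α : Type} (x : α) (L : List (α × Bool)) (h : ∀ p ∈ L, p.1 ≠ x) :
    kill x (FreeGroup.mk L) = FreeGroup.mk L :=
  hom_list (kill x) (MonoidHom.id _) L (fun p hp => kill_of_ne (h p hp))

lemma kill_filter {α : Type} (x : α) (L : List (α × Bool)) :
    kill x (FreeGroup.mk L) = FreeGroup.mk (L.filter (fun p => p.1 ≠ x)) := by
  induction L with
  | nil => rw [← FreeGroup.one_eq_mk, map_one]; rfl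
  | cons p L ih =>
    rw [mk_cons, map_mul, ih, List.filter_cons]
    by_cases h : p.1 = x
    · have : kill x (FreeGroup.mk [p]) = (1 : FreeGroup α →* FreeGroup α) (FreeGroup.mk [p]) := by
        apply hom_single
        rw [h, kill_self]; rfl
      rw [this]
      simp [h]
    · rw [if_pos (by simpa using h), kill_mk x [p] (by simpa using h)]
      exact (mk_cons p _).symm

lemma kill_idem {α : Type} (x : α) (w : FreeGroup α) : kill x (kill x w) = kill x w := by
  have : (kill x).comp (kill x) = kill x := by
    ext y
    by_cases h : y = x
    · simp [kill, h]
    · simp [kill, h]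
  exact DFunLike.congr_fun this w

lemma omit_list {α : Type} {x : α} {w : FreeGroup α} (h : kill x w = w) :
    ∃ L : List (α × Bool), w = FreeGroup.mk L ∧ ∀ p ∈ L, p.1 ≠ x := by
  refine ⟨w.toWord.filter (fun p => p.1 ≠ x), ?_, ?_⟩
  · rw [← kill_filter, FreeGroup.mk_toWord, h]
  · intro p hp
    simpa using (List.mem_filter.1 hp).2

lemma not_ess {α : Type} {r s : FreeGroup α} {x : α} (h : IsConj r s) (hs : kill x s = s) :
    ¬ Ess r x := by
  intro h'
  apply h'
  have := (kill x).map_isConj h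
  rw [hs] at this
  exact h.trans this.symm

lemma Ess.conj {α : Type} {r s : FreeGroup α} {x : α} (h : IsConj r s) (hr : Ess r x) :
    Ess s x := by
  intro h'
  exact not_ess (h.trans h') (kill_idem x s) hr

lemma FS.conj {α : Type} {r s : FreeGroup α} {x : α} (h : IsConj r s) (hr : FS r x) :
    FS s x := by
  intro w hw hsw
  apply hr w hw
  obtain ⟨g, hg⟩ := pm_lift s (pm r) (pm_conj h)
  rw [← hg, hsw, map_one]

lemma ess_mem {α : Type} {L : List (α × Bool)} {x : α} (h : Ess (FreeGroup.mk L) x) :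
    ∃ p ∈ L, p.1 = x := by
  by_contra hc
  push Not at hc
  exact not_ess (IsConj.refl _) (kill_mk x L hc) h

lemma filter_lt {α : Type} {L : List (α × Bool)} {p : α × Bool} (hp : p ∈ L) :
    (L.filter (fun q => q.1 ≠ p.1)).length < L.length := by
  rw [List.length_filter_lt_length_iff_exists]
  exact ⟨p, hp, by simp⟩

/-- exponent sum -/
noncomputable def sg {α : Type} (t : α) : FreeGroup α →* Multiplicative ℤ :=
  FreeGroup.lift (fun y => if y = t then Multiplicative.ofAdd 1 else 1)

lemma sg_self {α : Type} (t : α) : sg t (FreeGroup.of t) = Multiplicative.ofAdd 1 := by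
  simp [sg]

lemma sg_ne {α : Type} {t y : α} (h : y ≠ t) : sg t (FreeGroup.of y) = 1 := by
  simp [sg, h]

lemma sg_kill {α : Type} (t : α) (w : FreeGroup α) : sg t (kill t w) = 1 := by
  have : (sg t).comp (kill t) = 1 := by
    ext y
    by_cases h : y = t
    · simp [kill, h]
    · simp [kill, h, sg]
  exact DFunLike.congr_fun this w

lemma ess_of_sg {α : Type} {r : FreeGroup α} {x : α} (h : sg x r ≠ 1) : Ess r x := by
  intro h'
  have := (sg x).map_isConj h'
  rw [sg_kill] at this
  exact h (isConj_one_left.1 this)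

lemma sg_zpow {α : Type} (t : α) (n : ℤ) :
    sg t (FreeGroup.of t ^ n) = Multiplicative.ofAdd n := by
  rw [map_zpow, sg_self, ← ofAdd_zsmul]; simp

end ORG

namespace ORG
open Pointwise
open Classical

noncomputable def Th {α : Type} (t : α) : FreeGroup (α × ℤ) →* FreeGroup α :=
  FreeGroup.lift (fun p => FreeGroup.of t ^ p.2 * FreeGroup.of p.1 * (FreeGroup.of t ^ p.2)⁻¹)

lemma Th_of {α : Type} (t : α) (z : α) (i : ℤ) : Th t (FreeGroup.of (z, i)) =
    FreeGroup.of t ^ i * FreeGroup.of z * (FreeGroup.of t ^ i)⁻¹ := by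
  simp [Th]

def shl {α : Type} (i : ℤ) (L : List ((α × ℤ) × Bool)) : List ((α × ℤ) × Bool) :=
  L.map (fun p => ((p.1.1, i + p.1.2), p.2))

lemma Th_shl {α : Type} (t : α) (i : ℤ) (L : List ((α × ℤ) × Bool)) :
    Th t (FreeGroup.mk (shl i L)) =
      FreeGroup.of t ^ i * Th t (FreeGroup.mk L) * (FreeGroup.of t ^ i)⁻¹ := by
  have h1 : FreeGroup.mk (shl i L) =
      FreeGroup.map (fun p : α × ℤ => (p.1, i + p.2)) (FreeGroup.mk L) := by
    rw [FreeGroup.map.mk]; rfl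
  rw [h1]
  have h2 : (Th t).comp (FreeGroup.map (fun p : α × ℤ => (p.1, i + p.2))) =
      (MulAut.conj (FreeGroup.of t ^ i)).toMonoidHom.comp (Th t) := by
    ext ⟨z, j⟩
    simp only [MonoidHom.comp_apply, FreeGroup.map.of, Th_of, MulEquiv.coe_toMonoidHom,
      MulAut.conj_apply, zpow_add]
    group
  exact DFunLike.congr_fun h2 (FreeGroup.mk L)

/-- controlled rewriting -/
def Q {α : Type} (t : α) (P : α → Prop) (k : ℕ) (r : FreeGroup α) : Prop :=
  ∃ (L : List ((α × ℤ) × Bool)) (i : ℤ), L.length ≤ k ∧ (∀ p ∈ L, p.1.1 ≠ t ∧ P p.1.1) ∧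
    r = Th t (FreeGroup.mk L) * FreeGroup.of t ^ i

lemma Q.mul {α : Type} {t : α} {P : α → Prop} {k l : ℕ} {r s : FreeGroup α}
    (hr : Q t P k r) (hs : Q t P l s) : Q t P (k + l) (r * s) := by
  obtain ⟨L, i, h1, h2, rfl⟩ := hr
  obtain ⟨M, j, h3, h4, rfl⟩ := hs
  refine ⟨L ++ shl i M, i + j, ?_, ?_, ?_⟩
  · simp [shl]; omega
  · intro p hp
    rcases List.mem_append.1 hp with hp | hp
    · exact h2 p hp
    · obtain ⟨q, hq, rfl⟩ := List.mem_map.1 hp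
      exact h4 q hq
  · rw [← FreeGroup.mul_mk, map_mul, Th_shl, zpow_add]
    group

lemma Q.inv {α : Type} {t : α} {P : α → Prop} {k : ℕ} {r : FreeGroup α}
    (hr : Q t P k r) : Q t P k r⁻¹ := by
  obtain ⟨L, i, h1, h2, rfl⟩ := hr
  refine ⟨shl (-i) (FreeGroup.invRev L), -i, ?_, ?_, ?_⟩
  · simpa [shl] using h1
  · intro p hp
    obtain ⟨q, hq, rfl⟩ := List.mem_map.1 hp
    simp only [FreeGroup.invRev, List.mem_reverse, List.mem_map] at hq
    obtain ⟨q', hq', rfl⟩ := hq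
    exact h2 q' hq'
  · rw [Th_shl, ← FreeGroup.inv_mk, map_inv]
    group

lemma Q.hom {α : Type} {t : α} {P : α → Prop} (f : FreeGroup α →* FreeGroup α)
    (L : List (α × Bool)) (ht : Q t P 0 (f (FreeGroup.of t)))
    (h : ∀ p ∈ L, p.1 ≠ t → Q t P 1 (f (FreeGroup.of p.1))) :
    Q t P (L.countP (fun p => p.1 ≠ t)) (f (FreeGroup.mk L)) := by
  induction L with
  | nil => exact ⟨[], 0, by simp, by simp, by rw [← FreeGroup.one_eq_mk]; simp [← FreeGroup.one_eq_mk]⟩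
  | cons p L ih =>
    have ih := ih (fun q hq => h q (List.mem_cons_of_mem _ hq))
    rw [mk_cons, map_mul, List.countP_cons, add_comm]
    refine Q.mul ?_ ih
    obtain ⟨a, b⟩ := p
    by_cases hat : a = t
    · subst hat
      simp only [ne_eq, not_true_eq_false, decide_false]
      cases b
      · rw [mk_single_false, map_inv]; exact ht.inv
      · exact ht
    · have := h (a, b) List.mem_cons_self hat
      simp only [ne_eq, hat, not_false_eq_true, decide_true, if_true]
      cases b
      · rw [mk_single_false, map_inv]; exact this.inv
      · exact this

lemma Q.tpow {α : Type} (t : α) (P : α → Prop) (i : ℤ) : Q t P 0 (FreeGroup.of t ^ i) :=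
  ⟨[], i, by simp, by simp, by rw [← FreeGroup.one_eq_mk]; simp⟩

lemma Q.letter {α : Type} {t z : α} {P : α → Prop} (hz : z ≠ t) (hP : P z) :
    Q t P 1 (FreeGroup.of z) :=
  ⟨[((z, 0), true)], 0, by simp, by simp [hz, hP], by
    rw [mk_single_true, Th_of]; simp⟩

lemma Q.self {α : Type} (t : α) (L : List (α × Bool)) :
    Q t (fun z => ∃ p ∈ L, p.1 = z) (L.countP (fun p => p.1 ≠ t)) (FreeGroup.mk L) :=
  Q.hom (MonoidHom.id _) L (by simpa using Q.tpow t _ 1)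
    (fun p hp hpt => Q.letter hpt ⟨p, hp, rfl⟩)

lemma sg_Th {α : Type} (t : α) (L : List ((α × ℤ) × Bool)) (h : ∀ p ∈ L, p.1.1 ≠ t) :
    sg t (Th t (FreeGroup.mk L)) = 1 := by
  have := hom_list ((sg t).comp (Th t)) 1 L (by
    intro p hp
    obtain ⟨⟨z, i⟩, b⟩ := p
    simp only [MonoidHom.comp_apply, Th_of, map_mul, map_inv]
    rw [sg_ne (h _ hp)]; simp)
  exact this

lemma Q.zero {α : Type} {t : α} {P : α → Prop} {k : ℕ} {r : FreeGroup α}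
    (hr : Q t P k r) (h : sg t r = 1) :
    ∃ L : List ((α × ℤ) × Bool), L.length ≤ k ∧ (∀ p ∈ L, p.1.1 ≠ t ∧ P p.1.1) ∧
    r = Th t (FreeGroup.mk L) := by
  obtain ⟨L, i, h1, h2, rfl⟩ := hr
  refine ⟨L, h1, h2, ?_⟩
  rw [map_mul, sg_Th t L (fun p hp => (h2 p hp).1), sg_zpow, one_mul] at h
  have : i = 0 := h
  simp [this]

abbrev BB {α : Type} (t y : α) (m M : ℤ) : Type :=
  {p : α × ℤ // p.1 ≠ t ∧ (p.1 = y → m ≤ p.2 ∧ p.2 ≤ M)}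

noncomputable def bv {α : Type} (t y : α) (m M : ℤ) : FreeGroup (BB t y m M) →* FreeGroup (α × ℤ) :=
  FreeGroup.map Subtype.val

lemma bv_of {α : Type} {t y : α} {m M : ℤ} (p : BB t y m M) :
    bv t y m M (FreeGroup.of p) = FreeGroup.of p.1 := by
  simp [bv]

lemma fa_inj {β : Type} (u : FreeGroup β) (x : β) (h : FS u x) :
    Function.Injective ((pm u).comp (FreeGroup.map (Subtype.val : {p : β // p ≠ x} → β))) := by
  rw [injective_iff_map_eq_one]
  intro w hw
  have h1 : kill x (FreeGroup.map (Subtype.val : {p : β // p ≠ x} → β) w) =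
      FreeGroup.map (Subtype.val : {p : β // p ≠ x} → β) w := by
    have : (kill x).comp (FreeGroup.map (Subtype.val : {p : β // p ≠ x} → β)) =
        FreeGroup.map (Subtype.val : {p : β // p ≠ x} → β) := by
      ext p
      simp [kill_of_ne p.2]
    exact DFunLike.congr_fun this w
  have h2 := h _ h1 hw
  have h3 : Function.Injective (FreeGroup.map (Subtype.val : {p : β // p ≠ x} → β)) :=
    FreeGroup.map_injective Subtype.val_injective
  exact h3 (by rw [h2, map_one])

end ORG

namespace ORG
open Pointwise
open Classical

lemma hnn_exists {G F F' : Type} [Group G] [Group F] [Group F'] (fA : F →* G) (fB : F' →* G)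
    (hA : Function.Injective fA) (hB : Function.Injective fB) (e : F ≃* F') :
    ∃ (E : Type) (_ : Group E) (i : G →* E) (s : E), Function.Injective i ∧
      (∀ w, s * i (fA w) * s⁻¹ = i (fB (e w))) ∧
      (∀ (H : Type) [Group H] (f : G →* H) (x : H), (∀ w, x * f (fA w) = f (fB (e w)) * x) →
        ∃ g : E →* H, (∀ a, g (i a) = f a) ∧ g s = x) ∧
      (AD 3 (Set.univ : Set G) → AD 2 (Set.univ : Set F) → AD 2 (Set.univ : Set F') →
        AD 3 (Set.univ : Set E)) := by
  have hex : ∃ φ : fA.range ≃* fB.range, ∀ w, φ (fA.rangeRestrict w) = fB.rangeRestrict (e w) := by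
    refine ⟨((MonoidHom.ofInjective hA).symm.trans e).trans (MonoidHom.ofInjective hB), ?_⟩
    intro w
    have h1 : fA.rangeRestrict w = MonoidHom.ofInjective hA w := rfl
    rw [h1]
    simp only [MulEquiv.trans_apply, MulEquiv.symm_apply_apply]
    rfl
  obtain ⟨φ, hφ⟩ := hex
  refine ⟨HNNExtension G fA.range fB.range φ, inferInstance, HNNExtension.of, HNNExtension.t,
    HNNExtension.of_injective φ, ?_, ?_, ?_⟩
  · intro w
    have := (HNNExtension.equiv_eq_conj (φ := φ) (fA.rangeRestrict w)).symm
    rw [hφ w] at this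
    exact this
  · intro H _ f x h
    have h' : ∀ a : fA.range, x * f a = f (φ a : G) * x := by
      intro a
      obtain ⟨w, rfl⟩ := fA.rangeRestrict_surjective a
      rw [hφ w]
      exact h w
    exact ⟨HNNExtension.lift f x h', HNNExtension.lift_of f x h', HNNExtension.lift_t f x h'⟩
  · intro h1 h2 h3
    exact hnn_AD fA fB hA hB φ h1 h2 h3

def shE {α : Type} {t y : α} {m M : ℤ} (hM : ((y, M) : α × ℤ).1 ≠ t ∧
      (((y, M) : α × ℤ).1 = y → m ≤ ((y, M) : α × ℤ).2 ∧ ((y, M) : α × ℤ).2 ≤ M))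
    (hm : ((y, m) : α × ℤ).1 ≠ t ∧
      (((y, m) : α × ℤ).1 = y → m ≤ ((y, m) : α × ℤ).2 ∧ ((y, m) : α × ℤ).2 ≤ M)) :
    {p : BB t y m M // p ≠ ⟨(y, M), hM⟩} ≃ {p : BB t y m M // p ≠ ⟨(y, m), hm⟩} where
  toFun p := ⟨⟨(p.1.1.1, p.1.1.2 + 1), p.1.2.1, fun h => by
      have h1 := p.1.2.2 h
      have h2 : p.1.1.2 ≠ M := fun h3 => p.2 (Subtype.ext (Prod.ext h h3))
      exact ⟨by dsimp; omega, by dsimp; omega⟩⟩, by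
      intro h
      have h1 := congrArg Subtype.val h
      have h2 := congrArg Prod.fst h1
      have h3 := congrArg Prod.snd h1
      have h4 := p.1.2.2 h2
      dsimp at h3
      omega⟩
  invFun p := ⟨⟨(p.1.1.1, p.1.1.2 - 1), p.1.2.1, fun h => by
      have h1 := p.1.2.2 h
      have h2 : p.1.1.2 ≠ m := fun h3 => p.2 (Subtype.ext (Prod.ext h h3))
      exact ⟨by dsimp; omega, by dsimp; omega⟩⟩, by
      intro h
      have h1 := congrArg Subtype.val h
      have h2 := congrArg Prod.fst h1
      have h3 := congrArg Prod.snd h1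
      have h4 := p.1.2.2 h2
      dsimp at h3
      omega⟩
  left_inv p := by
    apply Subtype.ext; apply Subtype.ext; simp
  right_inv p := by
    apply Subtype.ext; apply Subtype.ext; simp

lemma hnn_core {α : Type} {t y : α} {m M : ℤ} (hM : ((y, M) : α × ℤ).1 ≠ t ∧
      (((y, M) : α × ℤ).1 = y → m ≤ ((y, M) : α × ℤ).2 ∧ ((y, M) : α × ℤ).2 ≤ M))
    (hm : ((y, m) : α × ℤ).1 ≠ t ∧
      (((y, m) : α × ℤ).1 = y → m ≤ ((y, m) : α × ℤ).2 ∧ ((y, m) : α × ℤ).2 ≤ M))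
    (u : FreeGroup (BB t y m M)) (h1 : FS u ⟨(y, M), hM⟩) (h2 : FS u ⟨(y, m), hm⟩) :
    (∀ w, pm (Th t (bv t y m M u)) (Th t (bv t y m M w)) = 1 → pm u w = 1) ∧
    (AD 3 (Set.univ : Set (PG u)) → AD 3 (Set.univ : Set (PG (Th t (bv t y m M u))))) := by
  have hmM : m ≤ M := (hM.2 rfl).1
  obtain ⟨E, _, i, s, hi, hs, hlift, hAD⟩ := hnn_exists _ _ (fa_inj u _ h1) (fa_inj u _ h2)
    (FreeGroup.freeGroupCongr (shE hM hm))
  -- relation between consecutive letters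
  have hstep : ∀ (z : α) (j : ℤ) (h : z ≠ t ∧ (z = y → m ≤ j ∧ j ≤ M))
      (h' : z ≠ t ∧ (z = y → m ≤ j + 1 ∧ j + 1 ≤ M)),
      s * i (pm u (FreeGroup.of ⟨(z, j), h⟩)) * s⁻¹ = i (pm u (FreeGroup.of ⟨(z, j + 1), h'⟩)) := by
    intro z j h h'
    have hne : (⟨(z, j), h⟩ : BB t y m M) ≠ ⟨(y, M), hM⟩ := by
      intro hh
      have h1 := congrArg Subtype.val hh
      have h2 : z = y := congrArg Prod.fst h1
      have h3 : j = M := congrArg Prod.snd h1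
      have := h'.2 h2
      omega
    have := hs (FreeGroup.of ⟨⟨(z, j), h⟩, hne⟩)
    simpa [shE] using this
  let Ψ : FreeGroup α →* E := FreeGroup.lift (fun z =>
    if h : z ≠ t then s ^ (-m) * i (pm u (FreeGroup.of ⟨(z, m), h, fun _ => ⟨le_rfl, hmM⟩⟩)) * s ^ m
    else s)
  have hΨt : Ψ (FreeGroup.of t) = s := by simp [Ψ]
  have hΨz : ∀ z (h : z ≠ t), Ψ (FreeGroup.of z) =
      s ^ (-m) * i (pm u (FreeGroup.of ⟨(z, m), h, fun _ => ⟨le_rfl, hmM⟩⟩)) * s ^ m := by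
    intro z h
    simp only [Ψ, FreeGroup.lift_apply_of]
    rw [dif_pos h]
  have hconst : ∀ (z : α) (j : ℤ) (h : z ≠ t ∧ (z = y → m ≤ j ∧ j ≤ M)),
      s ^ (-j) * i (pm u (FreeGroup.of ⟨(z, j), h⟩)) * s ^ j = Ψ (FreeGroup.of z) := by
    intro z j
    rcases le_total m j with hj | hj
    · induction j, hj using Int.leInduction with
      | base => intro h; exact (hΨz z h.1).symm
      | succ j hj ih =>
        intro h
        have h0 : z ≠ t ∧ (z = y → m ≤ j ∧ j ≤ M) := ⟨h.1, fun e => ⟨hj, by have := h.2 e; omega⟩⟩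
        rw [← ih h0, ← hstep z j h0 h, neg_add, zpow_add, zpow_add]
        group
    · induction j, hj using Int.leInductionDown with
      | base => intro h; exact (hΨz z h.1).symm
      | pred j hj ih =>
        intro h
        have h0 : z ≠ t ∧ (z = y → m ≤ j ∧ j ≤ M) :=
          ⟨h.1, fun e => by have := h.2 e; omega⟩
        have h00 : z ≠ t ∧ (z = y → m ≤ j - 1 + 1 ∧ j - 1 + 1 ≤ M) := by simpa using h0
        have h3 := hstep z (j - 1) h h00
        have h4 : (⟨(z, j - 1 + 1), h00⟩ : BB t y m M) = ⟨(z, j), h0⟩ := by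
          apply Subtype.ext; simp
        rw [h4] at h3
        rw [← ih h0, ← h3, neg_sub, zpow_sub, zpow_sub, zpow_neg]
        group
  have hcomp : ∀ w, Ψ (Th t (bv t y m M w)) = i (pm u w) := by
    have : (Ψ.comp (Th t)).comp (bv t y m M) = i.comp (pm u) := by
      ext ⟨⟨z, j⟩, h⟩
      simp only [MonoidHom.comp_apply, bv_of, Th_of, map_mul, map_inv, map_zpow, hΨt]
      rw [← hconst z j h]
      group
    exact DFunLike.congr_fun this
  have hΨr : Ψ (Th t (bv t y m M u)) = 1 := by rw [hcomp, pm_self, map_one]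
  obtain ⟨Ψ', hΨ'⟩ := pm_lift _ Ψ hΨr
  refine ⟨?_, ?_⟩
  · intro w hw
    apply hi
    rw [← hcomp, ← hΨ', hw, map_one, map_one]
  · intro hu
    refine AD.of_injective Ψ' ?_ (hAD hu free_AD free_AD)
    obtain ⟨f, hf⟩ := pm_lift u ((pm (Th t (bv t y m M u))).comp ((Th t).comp (bv t y m M)))
      (pm_self _)
    obtain ⟨g, hg1, hg2⟩ := hlift _ f (pm (Th t (bv t y m M u)) (FreeGroup.of t)) (by
      intro w
      simp only [MonoidHom.comp_apply, hf]
      rw [← map_mul, ← map_mul]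
      congr 1
      have : (MulAut.conj (FreeGroup.of t)).toMonoidHom.comp (((Th t).comp (bv t y m M)).comp
          (FreeGroup.map Subtype.val)) = ((Th t).comp (bv t y m M)).comp ((FreeGroup.map
          Subtype.val).comp (FreeGroup.freeGroupCongr (shE hM hm)).toMonoidHom) := by
        ext ⟨⟨⟨z, j⟩, h⟩, hh⟩
        simp only [MonoidHom.comp_apply, bv_of, Th_of, FreeGroup.map.of, MulEquiv.coe_toMonoidHom,
          MulAut.conj_apply, FreeGroup.freeGroupCongr_apply, shE, Equiv.coe_fn_mk]
        rw [zpow_add]; group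
      have := DFunLike.congr_fun this w
      simp only [MonoidHom.comp_apply, MulEquiv.coe_toMonoidHom, MulAut.conj_apply] at this
      rw [← this]; group)
    refine Function.LeftInverse.injective (g := g) ?_
    intro x
    obtain ⟨w, rfl⟩ := pm_surj _ x
    rw [hΨ']
    have : g.comp Ψ = pm (Th t (bv t y m M u)) := by
      ext z
      by_cases hz : z = t
      · subst hz
        rw [MonoidHom.comp_apply, hΨt, hg2]
      · rw [MonoidHom.comp_apply, hΨz z hz]
        simp only [map_mul, map_zpow, hg1, hg2, hf, MonoidHom.comp_apply, bv_of,
          Th_of, map_inv]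
        group
    exact DFunLike.congr_fun this w

end ORG

namespace ORG
open Pointwise
open Classical

lemma lift_list {β : Type} (P : β → Prop) (K : List (β × Bool)) (h : ∀ p ∈ K, P p.1) :
    ∃ K' : List ({p : β // P p} × Bool), K'.map (fun p => (p.1.1, p.2)) = K := by
  refine ⟨K.pmap (fun p hp => (⟨p.1, hp⟩, p.2)) h, ?_⟩
  rw [List.map_pmap]
  simp

lemma core {α : Type} (t y : α) (L : List ((α × ℤ) × Bool)) (hLt : ∀ p ∈ L, p.1.1 ≠ t)
    (hmin : ∀ L' : List ((α × ℤ) × Bool), (∀ p ∈ L', p.1.1 ≠ t) →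
      IsConj (Th t (FreeGroup.mk L)) (Th t (FreeGroup.mk L')) → L.length ≤ L'.length)
    (hy : ∃ p ∈ L, p.1.1 = y)
    (IH : ∀ (β : Type) (K : List (β × Bool)) (x : β), K.length ≤ L.length →
      Ess (FreeGroup.mk K) x → FS (FreeGroup.mk K) x) :
    ∃ m M : ℤ, m ≤ M ∧ (∃ b, ((y, m), b) ∈ L) ∧ (∃ b, ((y, M), b) ∈ L) ∧
      (∀ (K : List ((α × ℤ) × Bool)) (q : (α × ℤ) × Bool), q ∈ L →
        (∀ p ∈ K, p.1.1 ≠ t ∧ (p.1.1 = y → m ≤ p.1.2 ∧ p.1.2 ≤ M)) → (∀ p ∈ K, p.1 ≠ q.1) →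
        pm (Th t (FreeGroup.mk L)) (Th t (FreeGroup.mk K)) = 1 → Th t (FreeGroup.mk K) = 1) ∧
      ((∀ (β : Type) (K : List (β × Bool)), K.length ≤ L.length →
        AD 3 (Set.univ : Set (PG (FreeGroup.mk K)))) →
        AD 3 (Set.univ : Set (PG (Th t (FreeGroup.mk L))))) := by
  let S := (L.filter (fun p => p.1.1 = y)).toFinset
  have hS : S.Nonempty := by
    obtain ⟨p, hp, hpy⟩ := hy
    exact ⟨p, by simp [S, hp, hpy]⟩
  obtain ⟨⟨⟨y1, m⟩, b1⟩, hp1, hmin1⟩ := S.exists_min_image (fun p => p.1.2) hS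
  obtain ⟨⟨⟨y2, M⟩, b2⟩, hp2, hmax2⟩ := S.exists_max_image (fun p => p.1.2) hS
  have hp1' : ((y1, m), b1) ∈ L ∧ y1 = y := by simpa [S] using hp1
  have hp2' : ((y2, M), b2) ∈ L ∧ y2 = y := by simpa [S] using hp2
  obtain ⟨h1, rfl⟩ := hp1'
  obtain ⟨h2, rfl⟩ := hp2'
  have hmM : m ≤ M := hmin1 _ hp2
  have hrange : ∀ p ∈ L, p.1.1 ≠ t ∧ (p.1.1 = y2 → m ≤ p.1.2 ∧ p.1.2 ≤ M) := by
    intro p hp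
    refine ⟨hLt p hp, fun hpy => ?_⟩
    have : p ∈ S := by simp [S, hp, hpy]
    exact ⟨hmin1 p this, hmax2 p this⟩
  obtain ⟨L', hL'⟩ := lift_list (fun p : α × ℤ => p.1 ≠ t ∧ (p.1 = y2 → m ≤ p.2 ∧ p.2 ≤ M)) L hrange
  have hmap : ∀ K : List (BB t y2 m M × Bool),
      bv t y2 m M (FreeGroup.mk K) = FreeGroup.mk (K.map (fun p => (p.1.1, p.2))) := by
    intro K
    rw [bv, FreeGroup.map.mk]
  have hlen : L'.length = L.length := by rw [← hL', List.length_map]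
  have hess : ∀ q ∈ L', Ess (FreeGroup.mk L') q.1 := by
    intro q hq hc
    rw [kill_filter] at hc
    have h3 := ((Th t).comp (bv t y2 m M)).map_isConj hc
    simp only [MonoidHom.comp_apply, hmap, hL'] at h3
    have h4 := hmin _ ?_ h3
    · have := filter_lt hq
      rw [List.length_map] at h4
      omega
    · intro p hp
      obtain ⟨p', hp', rfl⟩ := List.mem_map.1 hp
      exact p'.1.2.1
  have hFS : ∀ q ∈ L, ∃ hq, FS (FreeGroup.mk L') (⟨q.1, hq⟩ : BB t y2 m M) := by
    intro q hq
    rw [← hL'] at hq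
    obtain ⟨q', hq', rfl⟩ := List.mem_map.1 hq
    exact ⟨q'.1.2, IH _ L' q'.1 hlen.le (hess q' hq')⟩
  obtain ⟨hm, hFm⟩ := hFS _ h1
  obtain ⟨hM, hFM⟩ := hFS _ h2
  obtain ⟨c1, c2⟩ := hnn_core hM hm (FreeGroup.mk L') hFM hFm
  rw [hmap, hL'] at c1 c2
  refine ⟨m, M, hmM, ⟨_, h1⟩, ⟨_, h2⟩, ?_, ?_⟩
  · intro K q hq hK hKq hpm
    obtain ⟨K', hK'⟩ := lift_list (fun p : α × ℤ => p.1 ≠ t ∧ (p.1 = y2 → m ≤ p.2 ∧ p.2 ≤ M)) K hK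
    obtain ⟨hqq, hF⟩ := hFS q hq
    have := c1 (FreeGroup.mk K') (by rw [hmap, hK']; exact hpm)
    have := hF _ (kill_mk _ K' ?_) this
    · rw [← hK', ← hmap, this, map_one, map_one]
    · intro p hp hpe
      apply hKq ((p.1.1, p.2)) (by rw [← hK']; exact List.mem_map.2 ⟨p, hp, rfl⟩)
      rw [hpe]
  · intro h
    exact c2 (h _ L' hlen.le)

/-- minimal representative -/
lemma min_rep {α : Type} (t : α) (L : List ((α × ℤ) × Bool)) (hLt : ∀ p ∈ L, p.1.1 ≠ t) :
    ∃ L₁ : List ((α × ℤ) × Bool), L₁.length ≤ L.length ∧ (∀ p ∈ L₁, p.1.1 ≠ t) ∧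
      IsConj (Th t (FreeGroup.mk L)) (Th t (FreeGroup.mk L₁)) ∧
      ∀ L' : List ((α × ℤ) × Bool), (∀ p ∈ L', p.1.1 ≠ t) →
      IsConj (Th t (FreeGroup.mk L₁)) (Th t (FreeGroup.mk L')) → L₁.length ≤ L'.length := by
  have hex : ∃ n, ∃ L₁ : List ((α × ℤ) × Bool), L₁.length = n ∧ (∀ p ∈ L₁, p.1.1 ≠ t) ∧
      IsConj (Th t (FreeGroup.mk L)) (Th t (FreeGroup.mk L₁)) := ⟨_, L, rfl, hLt, IsConj.refl _⟩
  obtain ⟨L₁, h1, h2, h3⟩ := Nat.find_spec hex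
  refine ⟨L₁, ?_, h2, h3, ?_⟩
  · rw [h1]; exact Nat.find_min' hex ⟨L, rfl, hLt, IsConj.refl _⟩
  · intro L' h4 h5
    rw [h1]; exact Nat.find_min' hex ⟨L', rfl, h4, h3.trans h5⟩

end ORG

namespace ORG
open Pointwise
open Classical

noncomputable def psi {α : Type} (t x : α) (B e : ℤ) : FreeGroup α →* FreeGroup α :=
  FreeGroup.lift (fun z => if z = t then FreeGroup.of t ^ B else
    if z = x then FreeGroup.of x * FreeGroup.of t ^ e else FreeGroup.of z)

lemma psi_t {α : Type} (t x : α) (B e : ℤ) :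
    psi t x B e (FreeGroup.of t) = FreeGroup.of t ^ B := by simp [psi]

lemma psi_x {α : Type} {t x : α} (h : x ≠ t) (B e : ℤ) :
    psi t x B e (FreeGroup.of x) = FreeGroup.of x * FreeGroup.of t ^ e := by simp [psi, h]

lemma psi_z {α : Type} {t x z : α} (h : z ≠ t) (h' : z ≠ x) (B e : ℤ) :
    psi t x B e (FreeGroup.of z) = FreeGroup.of z := by simp [psi, h, h']

lemma root {α : Type} {t x : α} (hx : x ≠ t) {B : ℤ} (hB : B ≠ 0) (e : ℤ) (r : FreeGroup α)
    (ht : ∀ n : ℤ, pm r (FreeGroup.of t ^ n) = 1 → n = 0) (w : FreeGroup α)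
    (hw : pm (psi t x B e r) (psi t x B e w) = 1) : pm r w = 1 := by
  let G := Monoid.Coprod (PG r) (Multiplicative ℤ)
  let il : PG r →* G := Monoid.Coprod.inl
  let ir : Multiplicative ℤ →* G := Monoid.Coprod.inr
  have hil : Function.Injective il := Monoid.Coprod.inl_injective
  have hir : Function.Injective ir := Monoid.Coprod.inr_injective
  let fA : Multiplicative ℤ →* G := zpowersHom G (il (pm r (FreeGroup.of t)))
  let fB : Multiplicative ℤ →* G := zpowersHom G (ir (Multiplicative.ofAdd B))
  have hfA : Function.Injective fA := by
    rw [injective_iff_map_eq_one]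
    intro n hn
    have hn' : il (pm r (FreeGroup.of t)) ^ (Multiplicative.toAdd n) = 1 := hn
    rw [← map_zpow, ← map_zpow] at hn'
    have := ht _ (hil (by rw [hn', map_one]))
    exact this
  have hfB : Function.Injective fB := by
    rw [injective_iff_map_eq_one]
    intro n hn
    have hn' : ir (Multiplicative.ofAdd B) ^ (Multiplicative.toAdd n) = 1 := hn
    rw [← map_zpow] at hn'
    have h1 : (Multiplicative.ofAdd B) ^ (Multiplicative.toAdd n) = 1 := hir (by rw [hn', map_one])
    rw [← ofAdd_zsmul] at h1
    have h2 : (Multiplicative.toAdd n) • B = 0 := h1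
    have h3 : Multiplicative.toAdd n = 0 := by
      simpa [hB] using h2
    exact h3
  obtain ⟨E, _, i, s, hi, hs, -, -⟩ := hnn_exists fA fB hfA hfB (MulEquiv.refl _)
  have h1 := hs (Multiplicative.ofAdd 1)
  have h2 : fA (Multiplicative.ofAdd 1) = il (pm r (FreeGroup.of t)) := by simp [fA]
  have h3 : fB (Multiplicative.ofAdd 1) = ir (Multiplicative.ofAdd B) := by simp [fB]
  rw [MulEquiv.refl_apply, h2, h3] at h1
  let y1 : E := s⁻¹ * i (ir (Multiplicative.ofAdd 1)) * s
  have hy1 : y1 ^ B = i (il (pm r (FreeGroup.of t))) := by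
    have : y1 ^ B = s⁻¹ * (i (ir (Multiplicative.ofAdd 1))) ^ B * s := by
      have := (conj_zpow (a := s⁻¹) (b := i (ir (Multiplicative.ofAdd 1))) (i := B))
      rw [inv_inv] at this
      exact this
    have h4 : (Multiplicative.ofAdd (1 : ℤ)) ^ B = Multiplicative.ofAdd B := by
      rw [← ofAdd_zsmul]; simp
    rw [this, ← map_zpow, ← map_zpow, h4, ← h1]
    group
  let χ : FreeGroup α →* E := FreeGroup.lift (fun z => if z = t then y1 else
    if z = x then i (il (pm r (FreeGroup.of x))) * y1 ^ (-e) else i (il (pm r (FreeGroup.of z))))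
  have c1 : χ (FreeGroup.of t) = y1 := by simp [χ]
  have c2 : χ (FreeGroup.of x) = i (il (pm r (FreeGroup.of x))) * y1 ^ (-e) := by
    simp only [χ, FreeGroup.lift_apply_of]
    rw [if_neg hx, if_pos trivial]
  have c3 : ∀ z, z ≠ t → z ≠ x → χ (FreeGroup.of z) = i (il (pm r (FreeGroup.of z))) := by
    intro z hz hz'
    simp only [χ, FreeGroup.lift_apply_of]
    rw [if_neg hz, if_neg hz']
  have hcomp : ∀ v, χ (psi t x B e v) = i (il (pm r v)) := by
    have : χ.comp (psi t x B e) = (i.comp il).comp (pm r) := by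
      ext z
      simp only [MonoidHom.comp_apply]
      by_cases hz : z = t
      · rw [hz, psi_t, map_zpow, c1, hy1]
      · by_cases hz' : z = x
        · rw [hz', psi_x hx, map_mul, map_zpow, c1, c2]
          group
        · rw [psi_z hz hz', c3 z hz hz']
    exact DFunLike.congr_fun this
  obtain ⟨χ', hχ'⟩ := pm_lift (psi t x B e r) χ (by rw [hcomp, pm_self, map_one, map_one])
  apply hil
  apply hi
  rw [← hcomp, ← hχ', hw, map_one, map_one, map_one]

lemma pm_one {α : Type} (w : FreeGroup α) (h : pm 1 w = 1) : w = 1 := by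
  obtain ⟨g, hg⟩ := pm_lift (1 : FreeGroup α) (MonoidHom.id _) (map_one _)
  have := hg w
  rw [h, map_one] at this
  exact this.symm

lemma of_zpow_eq {α : Type} (t : α) (n : ℤ) (h : FreeGroup.of t ^ n = 1) : n = 0 := by
  have := sg_zpow t n
  rw [h, map_one] at this
  exact this.symm

lemma psi_inj {α : Type} {t x : α} (hx : x ≠ t) {B : ℤ} (hB : B ≠ 0) (e : ℤ) (w : FreeGroup α)
    (hw : psi t x B e w = 1) : w = 1 := by
  refine pm_one w (root hx hB e 1 (fun n hn => of_zpow_eq t n (pm_one _ hn)) w ?_)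
  rw [hw, map_one]
  exact map_one _

lemma sg_t_psi {α : Type} {t x : α} (hx : x ≠ t) (B e : ℤ) (w : FreeGroup α) :
    sg t (psi t x B e w) = sg t w ^ B * sg x w ^ e := by
  have : (sg t).comp (psi t x B e) =
      ((zpowGroupHom B).comp (sg t)) * ((zpowGroupHom e).comp (sg x)) := by
    ext z
    simp only [MonoidHom.comp_apply, MonoidHom.mul_apply, zpowGroupHom_apply]
    by_cases hz : z = t
    · rw [hz, psi_t, map_zpow, sg_ne hx.symm]; simp
    · by_cases hz' : z = x
      · rw [hz', psi_x hx, map_mul, map_zpow, sg_ne hx, sg_self, sg_self]; simp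
      · rw [psi_z hz hz', sg_ne hz, sg_ne hz']; simp
  exact DFunLike.congr_fun this w

lemma sg_x_psi {α : Type} {t x : α} (hx : x ≠ t) (B e : ℤ) (w : FreeGroup α) :
    sg x (psi t x B e w) = sg x w := by
  have : (sg x).comp (psi t x B e) = sg x := by
    ext z
    simp only [MonoidHom.comp_apply]
    by_cases hz : z = t
    · rw [hz, psi_t, map_zpow, sg_ne hx.symm]; simp
    · by_cases hz' : z = x
      · rw [hz', psi_x hx, map_mul, map_zpow, sg_ne hx.symm]; simp
      · rw [psi_z hz hz']
  exact DFunLike.congr_fun this w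

lemma three {α : Type} {t x : α} (hx : x ≠ t) (L : List (α × Bool))
    (h2 : sg x (FreeGroup.mk L) ≠ 1) :
    ∃ (B e : ℤ) (K : List ((α × ℤ) × Bool)), B ≠ 0 ∧ K.length ≤ L.countP (fun p => p.1 ≠ t) ∧
      (∀ p ∈ K, p.1.1 ≠ t) ∧ psi t x B e (FreeGroup.mk L) = Th t (FreeGroup.mk K) ∧
      Ess (Th t (FreeGroup.mk K)) x := by
  let a : ℤ := Multiplicative.toAdd (sg t (FreeGroup.mk L))
  let b : ℤ := Multiplicative.toAdd (sg x (FreeGroup.mk L))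
  have hb : b ≠ 0 := h2
  have hQ : Q t (fun _ => True) _ (psi t x b (-a) (FreeGroup.mk L)) :=
    Q.hom (psi t x b (-a)) L (by rw [psi_t]; exact Q.tpow _ _ _) (by
      intro p hp hpt
      by_cases hpx : p.1 = x
      · rw [hpx, psi_x hx]
        exact Q.mul (Q.letter hx trivial) (Q.tpow _ _ _)
      · rw [psi_z hpt hpx]
        exact Q.letter hpt trivial)
  obtain ⟨K, h3, h4, h5⟩ := hQ.zero (by
    rw [sg_t_psi hx]
    have e1 : sg t (FreeGroup.mk L) = Multiplicative.ofAdd a := rfl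
    have e2 : sg x (FreeGroup.mk L) = Multiplicative.ofAdd b := rfl
    rw [e1, e2, ← ofAdd_zsmul, ← ofAdd_zsmul, ← ofAdd_add, ofAdd_eq_one]
    simp only [smul_eq_mul]; ring)
  refine ⟨b, -a, K, hb, h3, fun p hp => (h4 p hp).1, h5, ?_⟩
  rw [← h5]
  apply ess_of_sg
  rw [sg_x_psi hx]
  exact h2

lemma countP_lt {α : Type} {L : List (α × Bool)} {t : α} (h : ∃ p ∈ L, p.1 = t) :
    L.countP (fun p => p.1 ≠ t) < L.length := by
  obtain ⟨p, hp, rfl⟩ := h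
  rw [List.countP_eq_length_filter]
  exact filter_lt hp

lemma caseA {α : Type} {t x : α} (K : List ((α × ℤ) × Bool)) (hK : ∀ p ∈ K, p.1.1 ≠ t)
    (IH : ∀ (β : Type) (K' : List (β × Bool)) (x : β), K'.length ≤ K.length →
      Ess (FreeGroup.mk K') x → FS (FreeGroup.mk K') x)
    (hxt : x ≠ t)
    (hess : Ess (Th t (FreeGroup.mk K)) x) :
    FS (Th t (FreeGroup.mk K)) x ∧
      ((∀ (β : Type) (K' : List (β × Bool)), K'.length ≤ K.length →
        AD 3 (Set.univ : Set (PG (FreeGroup.mk K')))) →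
        AD 3 (Set.univ : Set (PG (Th t (FreeGroup.mk K))))) := by
  obtain ⟨L, h1, h2, h3, h4⟩ := min_rep t K hK
  have hess' := hess.conj h3
  have hx : ∃ p ∈ L, p.1.1 = x := by
    by_contra hc
    push Not at hc
    refine not_ess (IsConj.refl _) ?_ hess'
    refine hom_list ((kill x).comp (Th t)) (Th t) L ?_
    rintro ⟨⟨z, i⟩, b⟩ hp
    simp only [MonoidHom.comp_apply, Th_of, map_mul, map_inv, map_zpow]
    rw [kill_of_ne (hc _ hp), kill_of_ne hxt.symm]
  obtain ⟨m, M, hmM, hm, ⟨b, hM⟩, c1, c2⟩ := core t x L h2 h4 hx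
    (fun β K' x hl => IH β K' x (hl.trans h1))
  refine ⟨FS.conj h3.symm ?_, ?_⟩
  · intro w hw hpw
    obtain ⟨N, rfl, hN⟩ := omit_list hw
    obtain ⟨g, hg⟩ := pm_lift _ (sg t) (sg_Th t L h2)
    have hs : sg t (FreeGroup.mk N) = 1 := by rw [← hg, hpw, map_one]
    obtain ⟨K', k1, k2, k3⟩ := (Q.self t N).zero hs
    rw [k3] at hpw ⊢
    have hne : ∀ p ∈ K', p.1.1 ≠ x := by
      intro p hp
      obtain ⟨q, hq, hqe⟩ := (k2 p hp).2
      rw [← hqe]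
      exact hN q hq
    refine c1 K' _ hM ?_ ?_ hpw
    · intro p hp
      exact ⟨(k2 p hp).1, fun h => absurd h (hne p hp)⟩
    · intro p hp h
      exact hne p hp (by rw [h])
  · intro hAD
    obtain ⟨g, hg⟩ := PG_conj_inj h3
    exact AD.of_injective g hg (c2 (fun β K' hl => hAD β K' (hl.trans h1)))

lemma caseB {α : Type} {t : α} (K : List ((α × ℤ) × Bool)) (hK : ∀ p ∈ K, p.1.1 ≠ t)
    (IH : ∀ (β : Type) (K' : List (β × Bool)) (x : β), K'.length ≤ K.length →
      Ess (FreeGroup.mk K') x → FS (FreeGroup.mk K') x)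
    (hess : Ess (Th t (FreeGroup.mk K)) t) :
    FS (Th t (FreeGroup.mk K)) t := by
  obtain ⟨L, h1, h2, h3, h4⟩ := min_rep t K hK
  have hess' := hess.conj h3
  have hne : ∃ p, p ∈ L := by
    by_contra hc
    push Not at hc
    have : L = [] := List.eq_nil_iff_forall_not_mem.2 hc
    refine not_ess (IsConj.refl _) ?_ hess'
    rw [this, ← FreeGroup.one_eq_mk, map_one, map_one]
  obtain ⟨p0, hp0⟩ := hne
  obtain ⟨m, M, hmM, hm, hM, c1, c2⟩ := core t p0.1.1 L h2 h4 ⟨p0, hp0, rfl⟩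
    (fun β K' x hl => IH β K' x (hl.trans h1))
  have hq : ∃ q ∈ L, q.1.2 ≠ m := by
    by_contra hc
    push Not at hc
    let v : FreeGroup α := FreeGroup.map Prod.fst (FreeGroup.mk L)
    have hv : Th t (FreeGroup.mk L) =
        ((MulAut.conj (FreeGroup.of t ^ m)).toMonoidHom.comp (FreeGroup.map Prod.fst))
          (FreeGroup.mk L) := by
      refine hom_list (Th t) _ L ?_
      rintro ⟨⟨z, i⟩, b⟩ hp
      have : i = m := hc _ hp
      simp only [MonoidHom.comp_apply, Th_of, FreeGroup.map.of, MulEquiv.coe_toMonoidHom,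
        MulAut.conj_apply, this]
    have hk : kill t v = v := by
      refine hom_list ((kill t).comp (FreeGroup.map Prod.fst)) (FreeGroup.map Prod.fst) L ?_
      intro p hp
      simp only [MonoidHom.comp_apply, FreeGroup.map.of]
      exact kill_of_ne (h2 p hp)
    refine not_ess (s := v) ?_ hk hess'
    apply IsConj.symm
    rw [isConj_iff]
    exact ⟨FreeGroup.of t ^ m, hv.symm⟩
  obtain ⟨q, hqL, hqm⟩ := hq
  refine FS.conj h3.symm ?_
  intro w hw hpw
  obtain ⟨N, rfl, hN⟩ := omit_list hw
  let K' : List ((α × ℤ) × Bool) := N.map (fun p => ((p.1, m), p.2))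
  have hK' : Th t (FreeGroup.mk K') =
      FreeGroup.of t ^ m * FreeGroup.mk N * (FreeGroup.of t ^ m)⁻¹ := by
    have e1 : FreeGroup.mk K' = FreeGroup.map (fun z => (z, m)) (FreeGroup.mk N) := by
      rw [FreeGroup.map.mk]
    rw [e1]
    have : (Th t).comp (FreeGroup.map (fun z => (z, m))) =
        (MulAut.conj (FreeGroup.of t ^ m)).toMonoidHom := by
      ext z
      simp only [MonoidHom.comp_apply, Th_of, FreeGroup.map.of, MulEquiv.coe_toMonoidHom,
        MulAut.conj_apply]
    exact DFunLike.congr_fun this (FreeGroup.mk N)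
  have h5 := c1 K' q hqL ?_ ?_ ?_
  · rw [hK'] at h5
    exact conj_eq_one_iff.1 h5
  · intro p hp
    obtain ⟨p', hp', rfl⟩ := List.mem_map.1 hp
    exact ⟨hN p' hp', fun _ => ⟨le_rfl, hmM⟩⟩
  · intro p hp he
    obtain ⟨p', hp', rfl⟩ := List.mem_map.1 hp
    exact hqm (by rw [← he])
  · rw [hK', map_mul, map_mul, hpw, map_inv]
    group

theorem FSm (n : ℕ) : ∀ (α : Type) (L : List (α × Bool)) (x : α), L.length ≤ n →
    Ess (FreeGroup.mk L) x → FS (FreeGroup.mk L) x := by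
  induction n using Nat.strong_induction_on with
  | _ n ih =>
  intro α L x hn hess
  by_cases h0 : ∃ p ∈ L, p.1 ≠ x
  · obtain ⟨p, hp, hpx⟩ := h0
    have hlt := countP_lt (L := L) ⟨p, hp, rfl⟩
    have hltx := countP_lt (ess_mem hess)
    set t := p.1 with ht
    by_cases hst : sg t (FreeGroup.mk L) = 1
    · obtain ⟨K, k1, k2, k3⟩ := (Q.self t L).zero hst
      rw [k3] at hess ⊢
      exact (caseA K (fun p hp => (k2 p hp).1)
        (fun β K' x hl => ih K'.length (by omega) β K' x le_rfl) hpx.symm hess).1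
    · by_cases hsx : sg x (FreeGroup.mk L) = 1
      · obtain ⟨K, k1, k2, k3⟩ := (Q.self x L).zero hsx
        rw [k3] at hess ⊢
        exact caseB K (fun p hp => (k2 p hp).1)
          (fun β K' x hl => ih K'.length (by omega) β K' x le_rfl) hess
      · obtain ⟨B, e, K, hB, k1, k2, k3, k4⟩ := three hpx.symm L hsx
        have hFS := (caseA K k2
          (fun β K' x hl => ih K'.length (by omega) β K' x le_rfl) hpx.symm k4).1
        rw [← k3] at hFS
        intro w hw hpw
        apply psi_inj hpx.symm hB e
        apply hFS
        · have : ((kill x).comp (psi t x B e)).comp (kill x) = (psi t x B e).comp (kill x) := by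
            ext z
            simp only [MonoidHom.comp_apply]
            by_cases hz : z = x
            · rw [hz, kill_self]; simp
            · rw [kill_of_ne hz]
              by_cases hz' : z = t
              · rw [hz', psi_t, map_zpow, kill_of_ne hpx]
              · rw [psi_z hz' hz, kill_of_ne hz]
          have := DFunLike.congr_fun this w
          simp only [MonoidHom.comp_apply, hw] at this
          exact this
        · obtain ⟨g, hg⟩ := pm_lift (FreeGroup.mk L)
            ((pm (psi t x B e (FreeGroup.mk L))).comp (psi t x B e)) (pm_self _)
          have := hg w
          rw [hpw, map_one] at this
          exact this.symm
  · push Not at h0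
    intro w hw hpw
    obtain ⟨g, hg⟩ := pm_lift (FreeGroup.mk L) (kill x) (by
      rw [kill_filter]
      have : L.filter (fun p => p.1 ≠ x) = [] := by
        rw [List.filter_eq_nil_iff]
        intro p hp
        simp [h0 p hp]
      rw [this]; rfl)
    rw [← hw, ← hg, hpw, map_one]

end ORG

namespace ORG
open Pointwise
open Classical

lemma AD_one {α : Type} {r : FreeGroup α} (hr : r = 1) : AD 3 (Set.univ : Set (PG r)) := by
  subst hr
  obtain ⟨g, hg⟩ := pm_lift (1 : FreeGroup α) (MonoidHom.id _) (map_one _)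
  refine AD.of_injective g ?_ free_AD.succ
  rw [injective_iff_map_eq_one]
  intro a ha
  obtain ⟨w, rfl⟩ := pm_surj _ a
  rw [hg] at ha
  have : w = 1 := ha
  rw [this, map_one]

noncomputable def cact (α C : Type) [Group C] : C →* MulAut (FreeGroup (α × C)) where
  toFun c := FreeGroup.freeGroupCongr (Equiv.prodCongr (Equiv.refl α) (Equiv.mulLeft c))
  map_one' := by
    ext x
    have : (FreeGroup.freeGroupCongr (Equiv.prodCongr (Equiv.refl α)
        (Equiv.mulLeft (1 : C)))).toMonoidHom = MonoidHom.id _ := by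
      ext ⟨a, b⟩; simp
    exact DFunLike.congr_fun this x
  map_mul' c d := by
    ext x
    have : (FreeGroup.freeGroupCongr (Equiv.prodCongr (Equiv.refl α)
        (Equiv.mulLeft (c * d)))).toMonoidHom =
        (FreeGroup.freeGroupCongr (Equiv.prodCongr (Equiv.refl α)
        (Equiv.mulLeft c))).toMonoidHom.comp (FreeGroup.freeGroupCongr (Equiv.prodCongr
        (Equiv.refl α) (Equiv.mulLeft d))).toMonoidHom := by
      ext ⟨a, b⟩; simp [mul_assoc]
    exact DFunLike.congr_fun this x

lemma cact_of {α C : Type} [Group C] (c : C) (a : α) (d : C) :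
    cact α C c (FreeGroup.of (a, d)) = FreeGroup.of (a, c * d) := by
  simp [cact]

lemma semi_AD (α C : Type) [Group C] [Finite C] :
    AD 2 (Set.univ : Set (SemidirectProduct (FreeGroup (α × C)) C (cact α C))) := by
  refine AD.nbhd (F := Set.range (SemidirectProduct.inr : C →* _)) (Set.finite_range _) ?_
    (AD.of_range (SemidirectProduct.inl : FreeGroup (α × C) →* _)
      SemidirectProduct.inl_injective free_AD)
  intro h _
  refine Set.mem_mul.2 ⟨SemidirectProduct.inr h.right, ⟨_, rfl⟩,
    SemidirectProduct.inl (cact α C (h.right⁻¹) h.left), ⟨_, rfl⟩, ?_⟩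
  rw [SemidirectProduct.ext_iff]
  constructor
  · simp
  · simp

lemma AD_pow {α : Type} {x : α} {N : ℤ} (hN : N ≠ 0) :
    AD 3 (Set.univ : Set (PG (FreeGroup.of x ^ N))) := by
  have hn : N.natAbs ≠ 0 := by simpa using hN
  have : NeZero N.natAbs := ⟨hn⟩
  let C := Multiplicative (ZMod N.natAbs)
  have : Finite C := inferInstanceAs (Finite (ZMod N.natAbs))
  let H := SemidirectProduct (FreeGroup (α × C)) C (cact α C)
  let f : FreeGroup α →* H := FreeGroup.lift (fun z =>
    if z = x then SemidirectProduct.inr (Multiplicative.ofAdd (1 : ZMod N.natAbs))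
    else SemidirectProduct.inl (FreeGroup.of (z, 1)))
  have fx : f (FreeGroup.of x) = SemidirectProduct.inr (Multiplicative.ofAdd (1 : ZMod N.natAbs)) := by
    simp [f]
  have fz : ∀ z, z ≠ x → f (FreeGroup.of z) = SemidirectProduct.inl (FreeGroup.of (z, 1)) := by
    intro z hz
    simp [f, hz]
  have hf : f (FreeGroup.of x ^ N) = 1 := by
    have h1 : (Multiplicative.ofAdd (1 : ZMod N.natAbs)) ^ N = 1 := by
      rw [← ofAdd_zsmul, ofAdd_eq_one, zsmul_one, ZMod.intCast_zmod_eq_zero_iff_dvd]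
      exact Int.natAbs_dvd.2 dvd_rfl
    rw [map_zpow, fx, ← map_zpow, h1, map_one]
  obtain ⟨g, hg⟩ := pm_lift _ f hf
  refine AD.of_injective g ?_ (semi_AD α C).succ
  let r := FreeGroup.of x ^ N
  let X : PG r := pm r (FreeGroup.of x)
  have hX : X ^ N.natAbs = 1 := by
    have h1 : X ^ N = 1 := by
      have := pm_self r
      rwa [map_zpow] at this
    rcases Int.natAbs_eq N with h | h
    · rw [h, zpow_natCast] at h1; exact h1
    · rw [h, zpow_neg, zpow_natCast, inv_eq_one] at h1; exact h1
  let c : C →* PG r := MonoidHom.mk' (fun c => X ^ (Multiplicative.toAdd c).val) (by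
    intro a b
    rw [toAdd_mul, ZMod.val_add, ← pow_eq_pow_mod _ hX, pow_add])
  have hc1 : c (Multiplicative.ofAdd (1 : ZMod N.natAbs)) = X := by
    change X ^ (1 : ZMod N.natAbs).val = X
    rw [ZMod.val_one_eq_one_mod, ← pow_eq_pow_mod _ hX, pow_one]
  let d : FreeGroup (α × C) →* PG r :=
    FreeGroup.lift (fun p => c p.2 * pm r (FreeGroup.of p.1) * (c p.2)⁻¹)
  let l : H →* PG r := SemidirectProduct.lift d c (by
    intro k
    ext ⟨a, b⟩
    simp only [MonoidHom.comp_apply, MulEquiv.coe_toMonoidHom, cact_of, MulAut.conj_apply]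
    simp only [d, FreeGroup.lift_apply_of, map_mul]
    group)
  have hl1 : ∀ k : C, l (SemidirectProduct.inr k) = c k :=
    fun k => SemidirectProduct.lift_inr _ _ _ k
  have hl2 : ∀ k : FreeGroup (α × C), l (SemidirectProduct.inl k) = d k :=
    fun k => SemidirectProduct.lift_inl _ _ _ k
  refine Function.LeftInverse.injective (g := l) ?_
  intro a
  obtain ⟨w, rfl⟩ := pm_surj _ a
  rw [hg]
  have : l.comp f = pm r := by
    ext z
    rw [MonoidHom.comp_apply]
    by_cases hz : z = x
    · rw [hz, fx, hl1]
      exact hc1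
    · rw [fz z hz, hl2]
      simp only [d, FreeGroup.lift_apply_of]
      rw [map_one, one_mul, inv_one, mul_one]
  exact DFunLike.congr_fun this w

theorem ADm (n : ℕ) : ∀ (α : Type) (L : List (α × Bool)), L.length ≤ n →
    AD 3 (Set.univ : Set (PG (FreeGroup.mk L))) := by
  induction n using Nat.strong_induction_on with
  | _ n ih =>
  intro α L hn
  by_cases he : ∃ p ∈ L, ¬ Ess (FreeGroup.mk L) p.1
  · obtain ⟨p, hp, hne⟩ := he
    rw [Ess, not_not, kill_filter] at hne
    have hlt := filter_lt hp
    obtain ⟨g, hg⟩ := PG_conj_inj hne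
    exact AD.of_injective g hg (ih _ (by omega) α _ le_rfl)
  push Not at he
  by_cases h0 : ∃ p, p ∈ L
  swap
  · push Not at h0
    have : L = [] := List.eq_nil_iff_forall_not_mem.2 h0
    exact AD_one (by rw [this]; rfl)
  obtain ⟨p, hp⟩ := h0
  have hex := he p hp
  have hltx := countP_lt (L := L) ⟨p, hp, rfl⟩
  set x := p.1
  by_cases h1 : ∃ q ∈ L, q.1 ≠ x
  · obtain ⟨q, hq, hqx⟩ := h1
    have het := he q hq
    have hltt := countP_lt (L := L) ⟨q, hq, rfl⟩
    set t := q.1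
    by_cases hst : sg t (FreeGroup.mk L) = 1
    · obtain ⟨K, k1, k2, k3⟩ := (Q.self t L).zero hst
      rw [k3] at hex ⊢
      exact (caseA K (fun p hp => (k2 p hp).1) (fun β K' x hl => FSm _ β K' x le_rfl)
        hqx.symm hex).2 (fun β K' hl => ih K'.length (by omega) β K' le_rfl)
    · by_cases hsx : sg x (FreeGroup.mk L) = 1
      · obtain ⟨K, k1, k2, k3⟩ := (Q.self x L).zero hsx
        rw [k3] at het ⊢
        exact (caseA K (fun p hp => (k2 p hp).1) (fun β K' x hl => FSm _ β K' x le_rfl)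
          hqx het).2 (fun β K' hl => ih K'.length (by omega) β K' le_rfl)
      · obtain ⟨B, e, K, hB, k1, k2, k3, k4⟩ := three hqx.symm L hsx
        have hAD := (caseA K k2 (fun β K' x hl => FSm _ β K' x le_rfl)
          hqx.symm k4).2 (fun β K' hl => ih K'.length (by omega) β K' le_rfl)
        rw [← k3] at hAD
        obtain ⟨g, hg⟩ := pm_lift (FreeGroup.mk L)
            ((pm (psi t x B e (FreeGroup.mk L))).comp (psi t x B e)) (pm_self _)
        refine AD.of_injective g ?_ hAD
        rw [injective_iff_map_eq_one]
        intro a ha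
        obtain ⟨w, rfl⟩ := pm_surj _ a
        rw [hg] at ha
        refine root hqx.symm hB e _ ?_ w ha
        intro k hk
        exact of_zpow_eq t k (FSm _ α L x le_rfl hex _
          (by rw [map_zpow, kill_of_ne hqx]) hk)
  · push Not at h1
    have hpow : FreeGroup.mk L =
        FreeGroup.of x ^ (Multiplicative.toAdd (sg x (FreeGroup.mk L))) := by
      refine hom_list (MonoidHom.id _) ((zpowersHom _ (FreeGroup.of x)).comp (sg x)) L ?_
      intro q hq
      rw [h1 q hq, MonoidHom.comp_apply, sg_self]
      simp
    by_cases hN : Multiplicative.toAdd (sg x (FreeGroup.mk L)) = 0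
    · exact AD_one (by rw [hpow, hN, zpow_zero])
    · rw [hpow]
      exact AD_pow hN

theorem AD_PG {α : Type} (r : FreeGroup α) : AD 3 (Set.univ : Set (PG r)) := by
  have := ADm _ α r.toWord le_rfl
  rwa [FreeGroup.mk_toWord] at this

end ORG

/-- A finitely generated one-relator group has asymptotic dimension at most `2`. -/
theorem asdim_one_relator {α : Type} [Finite α] (r : FreeGroup α) :
    asdim (PresentedGroup ({r} : Set (FreeGroup α))) ≤ 2 := by
  exact ORG.asdim_le_of_AD (ORG.AD_PG r)
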